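/- Let λ ∈ (0,1); let μ be a symmetric Borel probability measure on ℝ that is ⊞_λ-infinitely divisible with rectangular R-transform C, and let ν, ρ be symmetric Borel probability measures on ℝ such that ρ is the rectangular free convolution μ ⊞_λ ν, with subordination function ω₂(z) = H_ρ(z)/T(M_ρ(z) − C(H_ρ(z))). Then for every r ∈ (0,+∞), the limit of ω₂(z) as z → r with z ∈ ℂ⁺ exists in ℂ ∪ {∞}; that is, the restriction of ω₂ to ℂ⁺ extends continuously to (0,+∞). -/

import Mathlib

open MeasureTheory Complex Set Filter Topology

noncomputable section

/-- The upper half-plane. -/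
def UHP : Set ℂ := {z : ℂ | 0 < z.im}

/-- The nonnegative real axis, viewed as a subset of `ℂ`. -/
def posAxis : Set ℂ := {z : ℂ | z.im = 0 ∧ 0 ≤ z.re}

/-- `M_μ(z) = ∫ z t² / (1 - z t²) dμ(t)`. -/
def Mt (μ : Measure ℝ) (z : ℂ) : ℂ := ∫ t : ℝ, z * (t : ℂ) ^ 2 / (1 - z * (t : ℂ) ^ 2) ∂μ

/-- `H_μ(z) = z (1 + M_μ(z)) (1 + λ M_μ(z))`. -/
def Ht (l : ℝ) (μ : Measure ℝ) (z : ℂ) : ℂ :=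
  z * (1 + Mt μ z) * (1 + (l : ℂ) * Mt μ z)

/-- `T(w) = (λ w + 1)(w + 1)`. -/
def Tfun (l : ℝ) (w : ℂ) : ℂ := ((l : ℂ) * w + 1) * (w + 1)

/-- The rectangular `R`-transform with Lévy measure `G`:
`C(z) = z ∫ (1+t²)/(1-z t²) dG(t)`. -/
def rectC (G : Measure ℝ) (z : ℂ) : ℂ :=
  z * ∫ t : ℝ, (1 + (t : ℂ) ^ 2) / (1 - z * (t : ℂ) ^ 2) ∂G

/-- `μ` is `⊞_λ`-infinitely divisible with rectangular `R`-transform `C = rectC G`: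
`H_μ(x) = x T(C(H_μ(x)))` for `x < 0` close to `0`. -/
def IsRectInfDiv (l : ℝ) (μ G : Measure ℝ) : Prop :=
  ∃ ε > (0 : ℝ), ∀ x ∈ Set.Ioo (-ε) (0 : ℝ),
    Ht l μ (x : ℂ) = (x : ℂ) * Tfun l (rectC G (Ht l μ (x : ℂ)))

/-- `ρ` is the rectangular free convolution `μ ⊞_λ ν`, where `μ` has rectangular
`R`-transform `rectC G`. -/
def IsRectConv (l : ℝ) (G ν ρ : Measure ℝ) : Prop :=
  ∃ ε > (0 : ℝ), ∀ x ∈ Set.Ioo (-ε) (0 : ℝ),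
    Tfun l (Mt ρ (x : ℂ) - rectC G (Ht l ρ (x : ℂ))) ≠ 0 ∧
    Ht l ρ (x : ℂ) =
      Ht l ν (Ht l ρ (x : ℂ) / Tfun l (Mt ρ (x : ℂ) - rectC G (Ht l ρ (x : ℂ))))

lemma edge_log {G g : ℝ → ℂ} (hG : Continuous G) (hg : Continuous g)
    (h : ∀ t, Complex.exp (G t) = g t) (c : ℂ) (hc : ∀ t, 0 < (c * g t).re) (a b : ℝ) :
    G a - G b = Complex.log (c * g a) - Complex.log (c * g b) := by
  have hcont : Continuous (fun t => G t - Complex.log (c * g t)) := by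
    refine hG.sub ?_
    exact Continuous.clog (continuous_const.mul hg) (fun t => Or.inl (hc t))
  have hne : ∀ t, c * g t ≠ 0 := fun t h0 => by have := hc t; simp [h0] at this
  have key := Complex.isCoveringMap_exp.const_of_comp hcont (fun a b => by
    apply Subtype.ext
    show Complex.exp _ = Complex.exp _
    have hg0 : ∀ t, g t ≠ 0 := fun t h0 => hne t (by simp [h0])
    have hc0 : c ≠ 0 := fun h0 => hne a (by simp [h0])
    rw [Complex.exp_sub, Complex.exp_sub, Complex.exp_log (hne a), Complex.exp_log (hne b), h, h]
    have := hg0 a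
    have := hg0 b
    field_simp) a b
  linear_combination key

lemma log_rot {x : ℂ} (h1 : 0 < x.re) (h2 : 0 < (I * x).re) :
    Complex.log (I * x) = Complex.log x + Real.pi / 2 * I := by
  have hx0 : x ≠ 0 := fun h0 => by simp [h0] at h1
  have hi : x.im < 0 := by simpa using h2
  have ha : x.arg < 0 := Complex.arg_neg_iff.2 hi
  have hb : -(Real.pi / 2) < x.arg := by
    have := (Complex.abs_arg_lt_pi_div_two_iff (z := x)).2 (Or.inl h1)
    exact (abs_lt.1 this).1
  rw [Complex.log_mul I_ne_zero hx0, Complex.log_I]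
  · ring
  · rw [Complex.arg_I]
    constructor <;> linarith [Real.pi_pos]

lemma crossing {γ₁ γ₂ : ℝ → ℂ} (h1 : Continuous γ₁) (h2 : Continuous γ₂)
    (hl : ∀ t, (γ₁ 0).re < (γ₂ t).re) (hr : ∀ t, (γ₂ t).re < (γ₁ 1).re)
    (ht : ∀ s, (γ₁ s).im < (γ₂ 0).im) (hb : ∀ s, (γ₂ 1).im < (γ₁ s).im) :
    ∃ s t, γ₁ s = γ₂ t := by
  by_contra hcon
  push Not at hcon
  let g : ℝ × ℝ → ℂ := fun p => γ₁ p.1 - γ₂ p.2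
  have hgc : Continuous g := by fun_prop
  have hg0 : ∀ p, g p ≠ 0 := fun p => sub_ne_zero.2 (hcon _ _)
  obtain ⟨G, ⟨-, hG⟩, -⟩ := isCoveringMapOn_exp.existsUnique_continuousMap_lifts
    (⟨g, hgc⟩ : C(ℝ × ℝ, ℂ)) (a₀ := (0, 0)) (exp_log (hg0 (0, 0)))
    (fun x ↦ hg0 x)
  have hGe : ∀ p, Complex.exp (G p) = g p := fun p => congrFun hG p
  have hGc : Continuous G := G.continuous
  have e1 := edge_log (G := fun t => G (0, t)) (g := fun t => g (0, t)) (by fun_prop) (by fun_prop)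
    (fun t => hGe _) (-1) (fun t => by simpa [g] using hl t) 1 0
  have e2 := edge_log (G := fun t => G (t, 1)) (g := fun t => g (t, 1)) (by fun_prop) (by fun_prop)
    (fun t => hGe _) (-I) (fun t => by simpa [g] using hb t) 1 0
  have e3 := edge_log (G := fun t => G (1, t)) (g := fun t => g (1, t)) (by fun_prop) (by fun_prop)
    (fun t => hGe _) 1 (fun t => by simpa [g] using hr t) 0 1
  have e4 := edge_log (G := fun t => G (t, 0)) (g := fun t => g (t, 0)) (by fun_prop) (by fun_prop)
    (fun t => hGe _) I (fun t => by simpa [g] using ht t) 0 1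
  have c1 := log_rot (x := -1 * g (0, 1)) (by simpa [g] using hl 1) (by simpa [g] using hb 0)
  have c2 := log_rot (x := -I * g (1, 1)) (by simpa [g] using hb 1)
    (by rw [← mul_assoc]; simpa [g] using hr 1)
  have c3 := log_rot (x := 1 * g (1, 0)) (by simpa [g] using hr 0) (by simpa [g] using ht 1)
  have c4 := log_rot (x := I * g (0, 0)) (by simpa [g] using ht 0)
    (by rw [← mul_assoc]; simpa [g] using hl 0)
  have r1 : I * (-1 * g (0, 1)) = -I * g (0, 1) := by ring
  have r2 : I * (-I * g (1, 1)) = 1 * g (1, 1) := by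
    linear_combination (-g (1, 1)) * I_mul_I
  have r3 : I * (1 * g (1, 0)) = I * g (1, 0) := by ring
  have r4 : I * (I * g (0, 0)) = -1 * g (0, 0) := by
    linear_combination (g (0, 0)) * I_mul_I
  rw [r1] at c1
  rw [r2] at c2
  rw [r3] at c3
  rw [r4] at c4
  have : (2 * Real.pi * I : ℂ) = 0 := by
    linear_combination e1 + e2 + e3 + e4 - c1 - c2 - c3 - c4
  simp [Real.pi_ne_zero] at this

lemma isClosed_box (x₀ η Y : ℝ) :
    IsClosed {z : ℂ | |z.re - x₀| ≤ 4 ∧ η ≤ z.im ∧ z.im ≤ Y} := by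
  have h1 : IsClosed {z : ℂ | |z.re - x₀| ≤ 4} := isClosed_le (by fun_prop) continuous_const
  have h2 : IsClosed {z : ℂ | η ≤ z.im} := isClosed_le continuous_const (by fun_prop)
  have h3 : IsClosed {z : ℂ | z.im ≤ Y} := isClosed_le (by fun_prop) continuous_const
  exact h1.inter (h2.inter h3)

lemma isOpen_box (x₀ η Y : ℝ) :
    IsOpen {z : ℂ | |z.re - x₀| < 4 ∧ η < z.im ∧ z.im < Y} := by
  have h1 : IsOpen {z : ℂ | |z.re - x₀| < 4} := isOpen_lt (by fun_prop) continuous_const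
  have h2 : IsOpen {z : ℂ | η < z.im} := isOpen_lt continuous_const (by fun_prop)
  have h3 : IsOpen {z : ℂ | z.im < Y} := isOpen_lt (by fun_prop) continuous_const
  exact h1.inter (h2.inter h3)

/-- One-sided two-constants estimate in the strip. -/
lemma two_const {G : ℂ → ℂ} (hG : DifferentiableOn ℂ G {z | 0 < z.im ∧ z.im < Real.pi})
    (hG1 : ∀ z : ℂ, 0 < z.im → z.im < Real.pi → ‖G z‖ ≤ 1)
    {ε : ℝ} (hε : 0 < ε) (hε1 : ε < 1) {p : ℂ} (x₀ η Y : ℝ) (hx : p.re = x₀)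
    (hη : 0 < η) (hY : Y < Real.pi) (hp : 0 < p.im) (hpY : (Real.pi - p.im) / 2 ≤ Y - p.im)
    (hpp : p.im < Real.pi)
    {U : Set ℂ} (hU : ∀ z ∈ U, |z.re - x₀| ≤ 4 ∧ η ≤ z.im ∧ z.im ≤ Y) (hpU : p ∈ U)
    (hfr : ∀ z ∈ frontier U, ‖G z‖ ≤ ε ∨ |z.re - x₀| = 4 ∨ z.im = Y) :
    ‖G p‖ ≤ Real.exp (Real.log ε * ((Real.pi - p.im) / 32)) := by
  have hπ4 : Real.pi < 3.15 := Real.pi_lt_d2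
  have hY0 : 0 < Y := by linarith
  set B : ℝ := Y + 16 / Y with hB
  have hlog : Real.log ε < 0 := Real.log_neg hε hε1
  have hUc : ∀ z ∈ closure U, |z.re - x₀| ≤ 4 ∧ η ≤ z.im ∧ z.im ≤ Y := by
    have hcl : IsClosed {z : ℂ | |z.re - x₀| ≤ 4 ∧ η ≤ z.im ∧ z.im ≤ Y} := by
      exact isClosed_box _ _ _
    exact fun z hz => closure_minimal hU hcl hz
  let S : ℂ → ℂ := fun z => 16 - (z - x₀) ^ 2 + I * B * (z - x₀)
  have hSre : ∀ z, (S z).re = 16 - (z.re - x₀) ^ 2 + z.im ^ 2 - B * z.im := by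
    intro z
    simp [S, pow_two]
    ring
  have hbd : Bornology.IsBounded U := by
    refine (Metric.isBounded_closedBall (x := (x₀ : ℂ)) (r := 4 + Y)).subset ?_
    intro z hz
    obtain ⟨h1, h2, h3⟩ := hU z hz
    rw [Metric.mem_closedBall, dist_eq_norm]
    refine (Complex.norm_le_abs_re_add_abs_im _).trans ?_
    have : |(z - x₀).im| ≤ Y := by
      rw [abs_le]; simp; constructor <;> linarith
    have h4 : |(z - x₀).re| ≤ 4 := by simpa using h1
    linarith
  have hFd : DiffContOnCl ℂ (fun z => G z * Complex.exp (-(Real.log ε / 16 : ℝ) * S z)) U := by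
    apply DifferentiableOn.diffContOnCl
    refine DifferentiableOn.mul ?_ ?_
    · exact hG.mono (fun z hz => ⟨by linarith [(hUc z hz).2.1], by linarith [(hUc z hz).2.2]⟩)
    · fun_prop
  have hnorm : ∀ z, ‖G z * Complex.exp (-(Real.log ε / 16 : ℝ) * S z)‖
      = ‖G z‖ * Real.exp (-(Real.log ε / 16) * (S z).re) := by
    intro z
    rw [norm_mul, Complex.norm_exp]
    congr 2
    rw [← Complex.ofReal_neg, Complex.re_ofReal_mul]
  have hmain := Complex.norm_le_of_forall_mem_frontier_norm_le hbd hFd (C := 1) (fun z hz => by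
    obtain ⟨h1, h2, h3⟩ := hUc z (frontier_subset_closure hz)
    have hz1 := hG1 z (by linarith) (by linarith)
    have hq : z.im ^ 2 - B * z.im ≤ 0 := by
      have : 0 < 16 / Y := by positivity
      have : z.im * (z.im - B) ≤ 0 := mul_nonpos_of_nonneg_of_nonpos (by linarith) (by linarith)
      nlinarith
    rw [hnorm]
    rcases hfr z hz with h | h | h
    · have hs : (S z).re ≤ 16 := by rw [hSre]; nlinarith [sq_nonneg (z.re - x₀)]
      calc ‖G z‖ * Real.exp (-(Real.log ε / 16) * (S z).re)
          ≤ ε * Real.exp (-(Real.log ε / 16) * 16) := by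
            gcongr
            linarith
        _ = 1 := by
            rw [show -(Real.log ε / 16) * 16 = - Real.log ε by ring, Real.exp_neg,
              Real.exp_log hε]
            field_simp
    · have hs : (S z).re ≤ 0 := by
        rw [hSre]
        have : (z.re - x₀) ^ 2 = 16 := by rw [← sq_abs, h]; norm_num
        linarith
      have : Real.exp (-(Real.log ε / 16) * (S z).re) ≤ 1 := by
        rw [Real.exp_le_one_iff]
        exact mul_nonpos_of_nonneg_of_nonpos (by linarith) hs
      exact mul_le_one₀ hz1 (Real.exp_nonneg _) this
    · have hs : (S z).re ≤ 0 := by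
        rw [hSre, h]
        have : B * Y = Y ^ 2 + 16 := by rw [hB]; field_simp
        nlinarith [sq_nonneg (z.re - x₀)]
      have : Real.exp (-(Real.log ε / 16) * (S z).re) ≤ 1 := by
        rw [Real.exp_le_one_iff]
        exact mul_nonpos_of_nonneg_of_nonpos (by linarith) hs
      exact mul_le_one₀ hz1 (Real.exp_nonneg _) this) (subset_closure hpU)
  rw [hnorm] at hmain
  have hsp : (Real.pi - p.im) / 2 ≤ (S p).re := by
    rw [hSre, hx]
    have h16 : (Y - p.im) * (16 / Y - p.im) = 16 + p.im ^ 2 - B * p.im := by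
      rw [hB]; field_simp; ring
    have : 5 ≤ 16 / Y := by rw [le_div_iff₀ hY0]; linarith
    nlinarith
  have hpos := Real.exp_pos (-(Real.log ε / 16) * (S p).re)
  calc ‖G p‖ ≤ Real.exp ((Real.log ε / 16) * (S p).re) := by
        rw [show (Real.log ε / 16) * (S p).re = -(-(Real.log ε / 16) * (S p).re) by ring,
          Real.exp_neg, ← one_div, le_div_iff₀ hpos]
        exact hmain
    _ ≤ _ := by
        apply Real.exp_le_exp.2
        nlinarith

lemma strip_koebe {G : ℂ → ℂ} (hG : DifferentiableOn ℂ G {z | 0 < z.im ∧ z.im < Real.pi})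
    (hG1 : ∀ z : ℂ, 0 < z.im → z.im < Real.pi → ‖G z‖ ≤ 1)
    {ε : ℝ} (hε : 0 < ε) (hε1 : ε < 1) {p : ℂ} (hp : 0 < p.im) (hpp : p.im < Real.pi)
    {γ : ℝ → ℂ} (hγ : Continuous γ) {m M : ℝ} (hm : 0 < m) (hM : M < Real.pi)
    (hγm : ∀ t, m < (γ t).im ∧ (γ t).im < M)
    (hγ0 : (γ 0).re < p.re - 4) (hγ1 : p.re + 4 < (γ 1).re)
    (hγε : ∀ t, ‖G (γ t)‖ ≤ ε) (hcl : IsClosed (range γ)) :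
    ‖G p‖ ≤ Real.exp (Real.log ε * (min p.im (Real.pi - p.im) / 32)) := by
  have hlog : Real.log ε < 0 := Real.log_neg hε hε1
  have hπ4 : Real.pi < 3.15 := Real.pi_lt_d2
  by_cases hpΓ : p ∈ range γ
  · obtain ⟨t, rfl⟩ := hpΓ
    refine (hγε t).trans ?_
    conv_lhs => rw [← Real.exp_log hε]
    apply Real.exp_le_exp.2
    have := min_le_left (γ t).im (Real.pi - (γ t).im)
    nlinarith
  -- choose eta
  obtain ⟨η, hη, h1, h2, h3, h4⟩ : ∃ η : ℝ, 0 < η ∧ η < m ∧ M < Real.pi - η ∧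
      η ≤ (Real.pi - p.im) / 2 ∧ η ≤ p.im / 2 := by
    refine ⟨min (min (m / 2) ((Real.pi - M) / 2)) (min ((Real.pi - p.im) / 2) (p.im / 2)),
      ?_, ?_, ?_, ?_, ?_⟩
    · have : 0 < Real.pi - M := by linarith
      have : 0 < Real.pi - p.im := by linarith
      positivity
    · have := min_le_left (min (m / 2) ((Real.pi - M) / 2)) (min ((Real.pi - p.im) / 2) (p.im / 2))
      have := min_le_left (m / 2) ((Real.pi - M) / 2)
      linarith
    · have := min_le_left (min (m / 2) ((Real.pi - M) / 2)) (min ((Real.pi - p.im) / 2) (p.im / 2))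
      have := min_le_right (m / 2) ((Real.pi - M) / 2)
      linarith
    · exact (min_le_right _ _).trans (min_le_left _ _)
    · exact (min_le_right _ _).trans (min_le_right _ _)
  let Q : Set ℂ := {z | |z.re - p.re| < 4 ∧ η < z.im ∧ z.im < Real.pi - η}
  have hQo : IsOpen Q := by
    exact isOpen_box _ _ _
  have hWo : IsOpen (Q \ range γ) := hQo.sdiff hcl
  have hpW : p ∈ Q \ range γ := ⟨⟨by simp, by linarith, by linarith⟩, hpΓ⟩
  let V := connectedComponentIn (Q \ range γ) p
  have hVo : IsOpen V := hWo.connectedComponentIn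
  have hVc : IsConnected V := isConnected_connectedComponentIn_iff.2 hpW
  have hVs : V ⊆ Q \ range γ := connectedComponentIn_subset _ _
  have hpV : p ∈ V := mem_connectedComponentIn hpW
  have hVQ : ∀ z ∈ V, |z.re - p.re| ≤ 4 ∧ η ≤ z.im ∧ z.im ≤ Real.pi - η := fun z hz =>
    ⟨(hVs hz).1.1.le, (hVs hz).1.2.1.le, (hVs hz).1.2.2.le⟩
  have hVcl : ∀ z ∈ closure V, |z.re - p.re| ≤ 4 ∧ η ≤ z.im ∧ z.im ≤ Real.pi - η := by
    have hcl : IsClosed {z : ℂ | |z.re - p.re| ≤ 4 ∧ η ≤ z.im ∧ z.im ≤ Real.pi - η} := by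
      exact isClosed_box _ _ _
    exact fun z hz => closure_minimal hVQ hcl hz
  have hfr : ∀ z ∈ frontier V, ‖G z‖ ≤ ε ∨ |z.re - p.re| = 4 ∨ z.im = Real.pi - η ∨ z.im = η := by
    intro z hz
    have hzc := frontier_subset_closure hz
    obtain ⟨a1, a2, a3⟩ := hVcl z hzc
    by_contra hcon
    push Not at hcon
    obtain ⟨b0, b1, b2, b3⟩ := hcon
    have hzW : z ∈ Q \ range γ := by
      refine ⟨⟨lt_of_le_of_ne a1 b1, lt_of_le_of_ne a2 (Ne.symm b3), lt_of_le_of_ne a3 b2⟩, ?_⟩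
      rintro ⟨t, rfl⟩
      exact absurd (hγε t) (not_le.2 b0)
    have hzV : z ∈ V := by
      have hpre : IsPreconnected (insert z V) :=
        hVc.isPreconnected.subset_closure (subset_insert _ _)
          (insert_subset hzc subset_closure)
      exact hpre.subset_connectedComponentIn (mem_insert_of_mem _ hpV)
        (insert_subset hzW hVs) (mem_insert _ _)
    rw [hVo.frontier_eq] at hz
    exact hz.2 hzV
  by_cases hbot : ∀ z ∈ frontier V, z.im ≠ η
  · have := two_const hG hG1 hε hε1 p.re η (Real.pi - η) rfl hη (by linarith) hp (by linarith) hpp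
      hVQ hpV (fun z hz => by
        rcases hfr z hz with h | h | h | h
        · exact Or.inl h
        · exact Or.inr (Or.inl h)
        · exact Or.inr (Or.inr h)
        · exact absurd h (hbot z hz))
    refine this.trans (Real.exp_le_exp.2 ?_)
    have := min_le_right p.im (Real.pi - p.im)
    nlinarith
  by_cases htop : ∀ z ∈ frontier V, z.im ≠ Real.pi - η
  · let R : ℂ ≃ₜ ℂ := Homeomorph.subLeft (Real.pi * I + 2 * p.re)
    have hR : ∀ z, R z = (Real.pi * I + 2 * p.re) - z := fun z => rfl
    have hRre : ∀ z, (R z).re = 2 * p.re - z.re := fun z => by simp [hR]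
    have hRim : ∀ z, (R z).im = Real.pi - z.im := fun z => by simp [hR]
    have hRR : ∀ z, R (R z) = z := fun z => by simp [hR]
    have := two_const (G := fun z => G (R z)) (p := R p) (U := R ⁻¹' V)
      (by
        refine hG.comp ?_ ?_
        · have : (⇑R) = fun z => (Real.pi * I + 2 * p.re) - z := rfl
          rw [this]; fun_prop
        · intro z hz
          simp only [mem_ofPred_eq, hRim] at hz ⊢
          constructor <;> linarith [hz.1, hz.2])
      (fun z hz1 hz2 => hG1 _ (by rw [hRim]; linarith) (by rw [hRim]; linarith))
      hε hε1 p.re η (Real.pi - η) (by rw [hRre]; ring) hη (by linarith)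
      (by rw [hRim]; linarith) (by rw [hRim]; linarith) (by rw [hRim]; linarith)
      (fun z hz => by
        obtain ⟨a1, a2, a3⟩ := hVQ _ hz
        rw [hRim] at a2 a3
        rw [hRre, show 2 * p.re - z.re - p.re = -(z.re - p.re) by ring, abs_neg] at a1
        exact ⟨a1, by linarith, by linarith⟩)
      (by simpa [hRR] using hpV)
      (fun z hz => by
        rw [← R.preimage_frontier] at hz
        rcases hfr _ hz with h | h | h | h
        · exact Or.inl h
        · rw [hRre, show 2 * p.re - z.re - p.re = -(z.re - p.re) by ring, abs_neg] at h
          exact Or.inr (Or.inl h)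
        · exact absurd h (htop _ hz)
        · rw [hRim] at h
          exact Or.inr (Or.inr (by linarith)))
    simp only [hRR, hRim] at this
    refine this.trans (Real.exp_le_exp.2 ?_)
    have := min_le_left p.im (Real.pi - p.im)
    nlinarith
  exfalso
  push Not at hbot htop
  obtain ⟨zb, hzb, hb⟩ := hbot
  obtain ⟨zt, hzt, ht⟩ := htop
  obtain ⟨qb, hqbm, hqbV⟩ := mem_closure_iff.1 (frontier_subset_closure hzb) {z | z.im < m}
    (isOpen_lt (by fun_prop) continuous_const) (by simpa [hb] using h1)
  obtain ⟨qt, hqtm, hqtV⟩ := mem_closure_iff.1 (frontier_subset_closure hzt) {z | M < z.im}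
    (isOpen_lt continuous_const (by fun_prop)) (by simpa [ht] using h2)
  have hVp : IsPathConnected V := hVo.isConnected_iff_isPathConnected.1 hVc
  obtain ⟨σ, hσ⟩ := hVp.joinedIn qt hqtV qb hqbV
  have hσV : ∀ t, σ.extend t ∈ V := by
    intro t
    have : σ.extend t ∈ range σ := by rw [← σ.extend_range]; exact mem_range_self t
    obtain ⟨u, hu⟩ := this
    rw [← hu]; exact hσ u
  obtain ⟨s, t, hst⟩ := crossing (γ₁ := γ) (γ₂ := σ.extend) hγ σ.continuous_extend
    (fun t => by
      have := (abs_lt.1 (hVs (hσV t)).1.1).1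
      linarith)
    (fun t => by
      have := (abs_lt.1 (hVs (hσV t)).1.1).2
      linarith)
    (fun s => by
      have : σ.extend 0 = qt := by simp
      rw [this]
      exact (hγm s).2.trans hqtm)
    (fun s => by
      have : σ.extend 1 = qb := by simp
      rw [this]
      exact lt_trans hqbm (hγm s).1)
  exact (hVs (hσV t)).2 ⟨s, hst⟩

lemma mem_UHP {z : ℂ} : z ∈ UHP ↔ 0 < z.im := Iff.rfl

lemma isOpen_UHP : IsOpen UHP := isOpen_lt continuous_const Complex.continuous_im

lemma convex_UHP : Convex ℝ UHP := convex_halfSpace_im_gt 0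

lemma arg_mem_of_UHP {z : ℂ} (hz : z ∈ UHP) : 0 < z.arg ∧ z.arg < Real.pi := by
  have h1 : 0 < z.im := hz
  refine ⟨?_, Complex.arg_lt_pi_iff.2 (Or.inr h1.ne')⟩
  rcases (Complex.arg_nonneg_iff.2 h1.le).lt_or_eq with h | h
  · exact h
  · have := Complex.arg_eq_zero_iff.1 h.symm
    linarith [this.2]

lemma ne_zero_of_UHP {z : ℂ} (hz : z ∈ UHP) : z ≠ 0 := by
  rintro rfl
  simp [mem_UHP] at hz

lemma uhp_koebe {g θ : ℂ → ℂ} {r : ℂ} (hg : DifferentiableOn ℂ g UHP)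
    (hg1 : ∀ z ∈ UHP, ‖g z‖ ≤ 1) (hθ : ContinuousOn θ UHP) (hθU : ∀ z ∈ UHP, θ z ∈ UHP)
    (hgθ : ∀ z ∈ UHP, ‖g (θ z)‖ ≤ ‖z - r‖)
    (h0 : ∀ δ > 0, ∀ R > 0, ∃ z ∈ UHP, ‖z - r‖ < δ ∧ ‖θ z‖ < R)
    (hinf : ∀ δ > 0, ∀ R > 0, ∃ z ∈ UHP, ‖z - r‖ < δ ∧ R < ‖θ z‖) {p : ℂ} (hp : p ∈ UHP) :
    g p = 0 := by
  have hexp : ∀ z : ℂ, 0 < z.im → z.im < Real.pi → Complex.exp z ∈ UHP := by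
    intro z h1 h2
    rw [mem_UHP, Complex.exp_im]
    exact mul_pos (Real.exp_pos _) (Real.sin_pos_of_pos_of_lt_pi h1 h2)
  have hp0 := ne_zero_of_UHP hp
  have hpa := arg_mem_of_UHP hp
  set P := Complex.log p with hP
  have hPim : P.im = p.arg := Complex.log_im p
  have hPexp : Complex.exp P = p := Complex.exp_log hp0
  set c : ℝ := min P.im (Real.pi - P.im) / 32 with hc
  have hcpos : 0 < c := by
    have : 0 < min P.im (Real.pi - P.im) := lt_min (by rw [hPim]; exact hpa.1)
      (by rw [hPim]; linarith [hpa.2])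
    positivity
  have key : ∀ ε : ℝ, 0 < ε → ε < 1 → ‖g p‖ ≤ Real.exp (Real.log ε * c) := by
    intro ε hε hε1
    obtain ⟨z, hz, hzr, hz0⟩ := h0 ε hε (Real.exp (P.re - 4)) (Real.exp_pos _)
    obtain ⟨z', hz', hzr', hz0'⟩ := hinf ε hε (Real.exp (P.re + 4)) (Real.exp_pos _)
    let pr : ℝ → ℝ := fun t => (projIcc (0 : ℝ) 1 zero_le_one t : ℝ)
    have hprc : Continuous pr := continuous_subtype_val.comp continuous_projIcc
    have hprm : ∀ t, pr t ∈ Icc (0 : ℝ) 1 := fun t => (projIcc (0 : ℝ) 1 zero_le_one t).2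
    let L : ℝ → ℂ := fun t => AffineMap.lineMap z z' t
    have hLc : Continuous L := AffineMap.lineMap_continuous
    have hLU : ∀ t ∈ Icc (0 : ℝ) 1, L t ∈ UHP := fun t ht =>
      convex_UHP.segment_subset hz hz' (by
        rw [segment_eq_image_lineMap]; exact mem_image_of_mem _ ht)
    have hLr : ∀ t ∈ Icc (0 : ℝ) 1, ‖L t - r‖ < ε := fun t ht => by
      have := (convex_ball r ε).segment_subset (x := z) (y := z') (by simpa [dist_eq_norm] using hzr)
        (by simpa [dist_eq_norm] using hzr') (show L t ∈ _ by
        rw [segment_eq_image_lineMap]; exact mem_image_of_mem _ ht)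
      simpa [dist_eq_norm] using this
    let f : ℝ → ℂ := fun t => Complex.log (θ (L t))
    have hfc : ContinuousOn f (Icc 0 1) := by
      refine ContinuousOn.clog ?_ ?_
      · exact hθ.comp hLc.continuousOn hLU
      · intro t ht
        exact Or.inr (ne_of_gt (hθU _ (hLU t ht)))
    have hfim : ∀ t ∈ Icc (0 : ℝ) 1, 0 < (f t).im ∧ (f t).im < Real.pi := fun t ht => by
      rw [Complex.log_im]; exact arg_mem_of_UHP (hθU _ (hLU t ht))
    have hfexp : ∀ t ∈ Icc (0 : ℝ) 1, Complex.exp (f t) = θ (L t) := fun t ht =>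
      Complex.exp_log (ne_zero_of_UHP (hθU _ (hLU t ht)))
    have hfic : ContinuousOn (fun t => (f t).im) (Icc 0 1) :=
      Complex.continuous_im.comp_continuousOn hfc
    obtain ⟨t₁, ht₁, hmin⟩ := isCompact_Icc.exists_isMinOn (nonempty_Icc.2 zero_le_one) hfic
    obtain ⟨t₂, ht₂, hmax⟩ := isCompact_Icc.exists_isMaxOn (nonempty_Icc.2 zero_le_one) hfic
    have hγc : Continuous (fun t => f (pr t)) := hfc.comp_continuous hprc hprm
    have hrange : range (fun t => f (pr t)) = Set.image f (Icc 0 1) := by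
      ext y
      constructor
      · rintro ⟨t, rfl⟩
        exact ⟨pr t, hprm t, rfl⟩
      · rintro ⟨t, ht, rfl⟩
        refine ⟨t, ?_⟩
        simp [pr, projIcc_of_mem zero_le_one ht]
    have hclosed : IsClosed (range (fun t => f (pr t))) := by
      rw [hrange]
      exact (isCompact_Icc.image_of_continuousOn hfc).isClosed
    have hpr0 : pr 0 = 0 := by simp [pr]
    have hpr1 : pr 1 = 1 := by simp [pr]
    have hL0 : L 0 = z := by simp [L]
    have hL1 : L 1 = z' := by simp [L]
    have := strip_koebe (G := fun z => g (Complex.exp z)) (ε := ε) (p := P)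
      (γ := fun t => f (pr t)) (m := (f t₁).im / 2) (M := ((f t₂).im + Real.pi) / 2)
      (hg.comp Complex.differentiable_exp.differentiableOn (fun z hz => hexp z hz.1 hz.2))
      (fun z h1 h2 => hg1 _ (hexp z h1 h2)) hε hε1 (by rw [hPim]; exact hpa.1)
      (by rw [hPim]; exact hpa.2) hγc (by linarith [(hfim t₁ ht₁).1])
      (by linarith [(hfim t₂ ht₂).2])
      (fun t => by
        have a1 : (f t₁).im ≤ (f (pr t)).im := hmin (hprm t)
        have a2 : (f (pr t)).im ≤ (f t₂).im := hmax (hprm t)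
        constructor
        · linarith [(hfim t₁ ht₁).1]
        · linarith [(hfim t₂ ht₂).2])
      (by
        show (f (pr 0)).re < _
        rw [hpr0]
        show (Complex.log (θ (L 0))).re < _
        rw [hL0, Complex.log_re, Real.log_lt_iff_lt_exp (norm_pos_iff.2 (ne_zero_of_UHP (hθU z hz)))]
        exact hz0)
      (by
        show _ < (f (pr 1)).re
        rw [hpr1]
        show _ < (Complex.log (θ (L 1))).re
        have hre : (Complex.log (θ z')).re = Real.log ‖θ z'‖ := Complex.log_re _
        rw [hL1, hre,
          Real.lt_log_iff_exp_lt (norm_pos_iff.2 (ne_zero_of_UHP (hθU z' hz')))]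
        exact hz0')
      (fun t => by
        show ‖g (Complex.exp (f (pr t)))‖ ≤ ε
        rw [hfexp _ (hprm t)]
        exact (hgθ _ (hLU _ (hprm t))).trans (hLr _ (hprm t)).le)
      hclosed
    simpa only [hPexp] using this
  have hlim : Tendsto (fun ε : ℝ => Real.exp (Real.log ε * c)) (𝓝[>] 0) (𝓝 0) := by
    refine Real.tendsto_exp_atBot.comp ?_
    exact Real.tendsto_log_nhdsGT_zero.atBot_mul_const hcpos
  have hle : ‖g p‖ ≤ 0 := by
    refine ge_of_tendsto hlim ?_
    filter_upwards [Ioo_mem_nhdsGT (zero_lt_one (α := ℝ))] with ε hε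
    exact key ε hε.1 hε.2
  exact norm_le_zero_iff.1 hle

/-- Interior cluster points force convergence. -/
lemma interior_cluster {f ω : ℂ → ℂ} {r : ℂ} (hf : DifferentiableOn ℂ f UHP)
    (hfne : ∃ p ∈ UHP, f p ≠ 0) (hω : ContinuousOn ω UHP) (hωU : ∀ z ∈ UHP, ω z ∈ UHP)
    (hfω : ∀ z ∈ UHP, ‖f (ω z)‖ ≤ ‖z - r‖) {c : ℂ} (hc : c ∈ UHP)
    (hcl : ∀ δ > 0, ∀ τ > 0, ∃ z ∈ UHP, ‖z - r‖ < δ ∧ ‖ω z - c‖ < τ) :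
    Tendsto ω (𝓝[UHP] r) (𝓝 c) := by
  have hfa : AnalyticOnNhd ℂ f UHP := hf.analyticOnNhd isOpen_UHP
  have hev : ∀ᶠ z in 𝓝[≠] c, f z ≠ 0 := by
    rcases (hfa c hc).eventually_eq_zero_or_eventually_ne_zero with h | h
    · exfalso
      obtain ⟨p, hp, hpne⟩ := hfne
      exact hpne (hfa.eqOn_zero_of_preconnected_of_eventuallyEq_zero
        convex_UHP.isPreconnected hc h hp)
    · exact h
  rw [eventually_nhdsWithin_iff, Metric.eventually_nhds_iff] at hev
  obtain ⟨τ₀, hτ₀, hev⟩ := hev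
  obtain ⟨τ₁, hτ₁, hball⟩ := Metric.isOpen_iff.1 isOpen_UHP c hc
  rw [Metric.tendsto_nhds]
  intro τ₂ hτ₂
  obtain ⟨τ, hτ, h0, h1, h2⟩ : ∃ τ : ℝ, 0 < τ ∧ τ < τ₀ ∧ τ < τ₁ ∧ τ < τ₂ := by
    refine ⟨min τ₀ (min τ₁ τ₂) / 2, by positivity, ?_, ?_, ?_⟩
    · have := min_le_left τ₀ (min τ₁ τ₂); linarith
    · have := (min_le_right τ₀ (min τ₁ τ₂)).trans (min_le_left _ _); linarith
    · have := (min_le_right τ₀ (min τ₁ τ₂)).trans (min_le_right _ _); linarith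
  have hsU : Metric.sphere c τ ⊆ UHP := fun z hz => hball (by
    rw [Metric.mem_ball, Metric.mem_sphere.1 hz]; exact h1)
  obtain ⟨w₀, hw₀, hmin⟩ := (isCompact_sphere c τ).exists_isMinOn
    (NormedSpace.sphere_nonempty.2 hτ.le)
    ((hf.continuousOn.mono hsU).norm)
  have hmpos : 0 < ‖f w₀‖ := norm_pos_iff.2 (hev (by rw [Metric.mem_sphere.1 hw₀]; exact h0)
    (by
      intro h
      have : dist w₀ c = τ := hw₀
      rw [mem_singleton_iff.1 h, dist_self] at this
      linarith))
  set D := UHP ∩ Metric.ball r ‖f w₀‖ with hD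
  have hDpre : IsPreconnected D := (convex_UHP.inter (convex_ball _ _)).isPreconnected
  obtain ⟨z₀, hz₀, hz₀r, hz₀c⟩ := hcl _ hmpos τ hτ
  have hall : ∀ z ∈ D, dist (ω z) c < τ := by
    intro z hz
    by_contra hcon
    have himg : IsPreconnected (Set.image (fun z => dist (ω z) c) D) := by
      refine hDpre.image _ ?_
      exact (continuous_id.dist continuous_const).comp_continuousOn (hω.mono inter_subset_left)
    have hz₀D : z₀ ∈ D := ⟨hz₀, by simpa [dist_eq_norm] using hz₀r⟩
    have hmem : τ ∈ Set.image (fun z => dist (ω z) c) D := by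
      refine himg.ordConnected.out (mem_image_of_mem _ hz₀D) (mem_image_of_mem _ hz) ⟨?_, ?_⟩
      · simpa [dist_eq_norm] using hz₀c.le
      · exact not_lt.1 hcon
    obtain ⟨z₁, hz₁, hz₁τ⟩ := hmem
    have a1 : ‖f w₀‖ ≤ ‖f (ω z₁)‖ := hmin (show ω z₁ ∈ Metric.sphere c τ from hz₁τ)
    have a2 := hfω z₁ hz₁.1
    have a3 : ‖z₁ - r‖ < ‖f w₀‖ := by simpa [dist_eq_norm] using hz₁.2
    linarith
  have : D ∈ 𝓝[UHP] r := inter_mem self_mem_nhdsWithin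
    (mem_nhdsWithin_of_mem_nhds (Metric.ball_mem_nhds _ hmpos))
  filter_upwards [this] with z hz
  exact (hall z hz).trans h2

lemma im_div_formula (a b : ℂ) : (a / b).im = (a.im * b.re - a.re * b.im) / Complex.normSq b := by
  rw [Complex.div_im]; ring

lemma X_aux {f ω φ ψ : ℂ → ℂ} {r : ℂ} {B : ℝ} (hf : DifferentiableOn ℂ f UHP)
    (hB : ∀ z ∈ UHP, ‖f z‖ ≤ B)
    (hω : ContinuousOn ω UHP) (hωU : ∀ z ∈ UHP, ω z ∈ UHP)
    (hfω : ∀ z ∈ UHP, ‖f (ω z)‖ ≤ ‖z - r‖)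
    (hφ : DifferentiableOn ℂ φ UHP) (hφU : ∀ z ∈ UHP, φ z ∈ UHP)
    (hψ : ContinuousOn ψ UHP) (hψU : ∀ z ∈ UHP, ψ z ∈ UHP) (hφψ : ∀ z ∈ UHP, φ (ψ z) = z)
    (h0 : ∀ δ > 0, ∀ R > 0, ∃ z ∈ UHP, ‖z - r‖ < δ ∧ ‖ψ (ω z)‖ < R)
    (hinf : ∀ δ > 0, ∀ R > 0, ∃ z ∈ UHP, ‖z - r‖ < δ ∧ R < ‖ψ (ω z)‖) :
    ∀ p ∈ UHP, f p = 0 := by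
  have hB' : 0 < max B 1 := lt_max_of_lt_right one_pos
  have hBn : ‖((max B 1 : ℝ) : ℂ)‖ = max B 1 := by
    rw [Complex.norm_real, Real.norm_of_nonneg hB'.le]
  intro p hp
  have := uhp_koebe (g := fun u => f (φ u) / ((max B 1 : ℝ) : ℂ)) (θ := fun z => ψ (ω z)) (r := r)
    ((hf.comp hφ hφU).div_const _)
    (fun z hz => by
      rw [norm_div, hBn, div_le_one hB']
      exact (hB _ (hφU z hz)).trans (le_max_left _ _))
    (hψ.comp hω hωU) (fun z hz => hψU _ (hωU z hz))
    (fun z hz => by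
      rw [norm_div, hBn, hφψ _ (hωU z hz)]
      exact (div_le_self (norm_nonneg _) (le_max_right _ _)).trans (hfω z hz))
    h0 hinf (hψU p hp)
  rw [hφψ p hp, div_eq_zero_iff] at this
  rcases this with h | h
  · exact h
  · exfalso
    rw [Complex.ofReal_eq_zero] at h
    linarith

lemma X_reals {f ω : ℂ → ℂ} {r : ℂ} {B : ℝ} (hf : DifferentiableOn ℂ f UHP)
    (hB : ∀ z ∈ UHP, ‖f z‖ ≤ B)
    (hω : ContinuousOn ω UHP) (hωU : ∀ z ∈ UHP, ω z ∈ UHP)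
    (hfω : ∀ z ∈ UHP, ‖f (ω z)‖ ≤ ‖z - r‖) {c d : ℝ} (hcd : c < d)
    (hc : ∀ δ > 0, ∀ τ > 0, ∃ z ∈ UHP, ‖z - r‖ < δ ∧ ‖ω z - c‖ < τ)
    (hd : ∀ δ > 0, ∀ τ > 0, ∃ z ∈ UHP, ‖z - r‖ < δ ∧ ‖ω z - d‖ < τ) :
    ∀ p ∈ UHP, f p = 0 := by
  have hcd' : (d : ℂ) - c ≠ 0 := by
    rw [← Complex.ofReal_sub, Complex.ofReal_ne_zero]; linarith
  have hne : ∀ w ∈ UHP, ∀ x : ℝ, (x : ℂ) - w ≠ 0 := by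
    intro w hw x h
    have : ((x : ℂ) - w).im = 0 := by rw [h]; simp
    simp at this
    rw [mem_UHP] at hw; linarith
  have hne1 : ∀ w ∈ UHP, w + 1 ≠ 0 := by
    intro w hw h
    have : (w + 1).im = 0 := by rw [h]; simp
    simp at this
    rw [mem_UHP] at hw; linarith
  refine X_aux (φ := fun u => (d * u + c) / (u + 1)) (ψ := fun w => (w - c) / (d - w))
    hf hB hω hωU hfω ?_ ?_ ?_ ?_ ?_ ?_ ?_
  · intro u hu
    refine DifferentiableAt.differentiableWithinAt ?_
    have := hne1 u hu
    fun_prop (disch := assumption)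
  · intro u hu
    have h1 := Complex.normSq_pos.2 (hne1 u hu)
    rw [mem_UHP] at hu ⊢
    rw [im_div_formula]
    refine div_pos ?_ h1
    simp
    nlinarith
  · intro w hw
    refine ContinuousAt.continuousWithinAt ?_
    have := hne w hw d
    fun_prop (disch := assumption)
  · intro w hw
    have h1 := Complex.normSq_pos.2 (hne w hw d)
    rw [mem_UHP] at hw ⊢
    rw [im_div_formula]
    refine div_pos ?_ h1
    simp
    nlinarith
  · intro w hw
    have h1 := hne w hw d
    have h2 : (w - c) / (d - w) + 1 = (d - c) / (d - w) := by field_simp; ring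
    have h3 : d * ((w - c) / (d - w)) + c = w * ((d - c) / (d - w)) := by field_simp; ring
    show (d * ((w - c) / (d - w)) + c) / ((w - c) / (d - w) + 1) = w
    rw [h2, h3]
    field_simp
  · intro δ hδ R hR
    have hcont : ContinuousAt (fun w : ℂ => (w - c) / (d - w)) c := by
      fun_prop (disch := assumption)
    obtain ⟨τ, hτ, h⟩ := Metric.continuousAt_iff.1 hcont R hR
    obtain ⟨z, hz, hzr, hzc⟩ := hc δ hδ τ hτ
    refine ⟨z, hz, hzr, ?_⟩
    have := h (x := ω z) (by rw [dist_eq_norm]; exact hzc)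
    simpa [dist_eq_norm] using this
  · intro δ hδ R hR
    have hcont : ContinuousAt (fun w : ℂ => (d - w) / (w - c)) d := by
      fun_prop (disch := assumption)
    obtain ⟨τ, hτ, h⟩ := Metric.continuousAt_iff.1 hcont R⁻¹ (by positivity)
    obtain ⟨z, hz, hzr, hzc⟩ := hd δ hδ τ hτ
    refine ⟨z, hz, hzr, ?_⟩
    have := h (x := ω z) (by rw [dist_eq_norm]; exact hzc)
    have h1 : ‖(d - ω z) / (ω z - c)‖ < R⁻¹ := by simpa [dist_eq_norm] using this
    have h2 : 0 < ‖(d - ω z) / (ω z - c)‖ := by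
      refine norm_pos_iff.2 (div_ne_zero (hne _ (hωU z hz) d) ?_)
      rw [← neg_sub]
      exact neg_ne_zero.2 (hne _ (hωU z hz) c)
    have h3 : (ω z - c) / (d - ω z) = ((d - ω z) / (ω z - c))⁻¹ := by rw [inv_div]
    show R < ‖(ω z - c) / (d - ω z)‖
    rw [h3, norm_inv]
    exact (lt_inv_comm₀ h2 hR).1 h1

lemma X_inf {f ω : ℂ → ℂ} {r : ℂ} {B : ℝ} (hf : DifferentiableOn ℂ f UHP)
    (hB : ∀ z ∈ UHP, ‖f z‖ ≤ B)
    (hω : ContinuousOn ω UHP) (hωU : ∀ z ∈ UHP, ω z ∈ UHP)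
    (hfω : ∀ z ∈ UHP, ‖f (ω z)‖ ≤ ‖z - r‖) {c : ℝ}
    (hc : ∀ δ > 0, ∀ τ > 0, ∃ z ∈ UHP, ‖z - r‖ < δ ∧ ‖ω z - c‖ < τ)
    (hd : ∀ δ > 0, ∀ R > 0, ∃ z ∈ UHP, ‖z - r‖ < δ ∧ R < ‖ω z‖) :
    ∀ p ∈ UHP, f p = 0 := by
  refine X_aux (φ := fun u => u + c) (ψ := fun w => w - c)
    hf hB hω hωU hfω (by fun_prop) ?_ (by fun_prop) ?_ ?_ ?_ ?_
  · intro u hu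
    simpa [mem_UHP] using hu
  · intro u hu
    simpa [mem_UHP] using hu
  · intro u hu
    simp
  · intro δ hδ R hR
    exact hc δ hδ R hR
  · intro δ hδ R hR
    obtain ⟨z, hz, hzr, h⟩ := hd δ hδ (R + ‖(c : ℂ)‖) (by positivity)
    refine ⟨z, hz, hzr, ?_⟩
    have := norm_sub_norm_le (ω z) c
    linarith

lemma cluster_coe {ω : ℂ → ℂ} {r c : ℂ}
    (h : MapClusterPt (c : OnePoint ℂ) (𝓝[UHP] r) (fun z => (ω z : OnePoint ℂ))) :
    ∀ δ > 0, ∀ τ > 0, ∃ z ∈ UHP, ‖z - r‖ < δ ∧ ‖ω z - c‖ < τ := by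
  intro δ hδ τ hτ
  rw [mapClusterPt_iff_frequently] at h
  have h1 := h (Set.image (fun w : ℂ => (w : OnePoint ℂ)) (Metric.ball c τ)) (by
    rw [OnePoint.nhds_coe_eq]
    exact image_mem_map (Metric.ball_mem_nhds _ hτ))
  have h2 : ∀ᶠ z in 𝓝[UHP] r, z ∈ UHP ∧ ‖z - r‖ < δ := by
    refine eventually_mem_nhdsWithin.and (eventually_nhdsWithin_of_eventually_nhds ?_)
    filter_upwards [Metric.ball_mem_nhds r hδ] with z hz
    simpa [dist_eq_norm] using hz
  obtain ⟨z, ⟨w, hw, hwz⟩, hz, hzr⟩ := (h1.and_eventually h2).exists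
  have := OnePoint.coe_injective hwz
  subst this
  exact ⟨z, hz, hzr, by simpa [dist_eq_norm] using hw⟩

lemma cluster_inf {ω : ℂ → ℂ} {r : ℂ}
    (h : MapClusterPt (OnePoint.infty : OnePoint ℂ) (𝓝[UHP] r) (fun z => (ω z : OnePoint ℂ))) :
    ∀ δ > 0, ∀ R > 0, ∃ z ∈ UHP, ‖z - r‖ < δ ∧ R < ‖ω z‖ := by
  intro δ hδ R hR
  rw [mapClusterPt_iff_frequently] at h
  have h1 := h (Set.image (fun w : ℂ => (w : OnePoint ℂ)) (Metric.closedBall 0 R)ᶜ ∪ {OnePoint.infty})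
    (OnePoint.hasBasis_nhds_infty.mem_of_mem ⟨Metric.isClosed_closedBall, isCompact_closedBall _ _⟩)
  have h2 : ∀ᶠ z in 𝓝[UHP] r, z ∈ UHP ∧ ‖z - r‖ < δ := by
    refine eventually_mem_nhdsWithin.and (eventually_nhdsWithin_of_eventually_nhds ?_)
    filter_upwards [Metric.ball_mem_nhds r hδ] with z hz
    simpa [dist_eq_norm] using hz
  obtain ⟨z, hz', hz, hzr⟩ := (h1.and_eventually h2).exists
  rcases hz' with ⟨w, hw, hwz⟩ | hz'
  · have := OnePoint.coe_injective hwz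
    subst this
    exact ⟨z, hz, hzr, by simpa [dist_eq_norm] using hw⟩
  · exact absurd hz' (OnePoint.coe_ne_infty _)

theorem boundary_limit {f ω : ℂ → ℂ} {r : ℝ} {B : ℝ} (hf : DifferentiableOn ℂ f UHP)
    (hB : ∀ z ∈ UHP, ‖f z‖ ≤ B) (hfne : ∃ p ∈ UHP, f p ≠ 0)
    (hω : ContinuousOn ω UHP) (hωU : ∀ z ∈ UHP, ω z ∈ UHP)
    (hfω : ∀ z ∈ UHP, ‖f (ω z)‖ ≤ ‖z - r‖) :
    ∃ L : OnePoint ℂ, Tendsto (fun z => (ω z : OnePoint ℂ)) (𝓝[UHP] (r : ℂ)) (𝓝 L) := by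
  by_contra hcon
  push Not at hcon
  have hno : ¬ ∀ p ∈ UHP, f p = 0 := by
    obtain ⟨p, hp, h⟩ := hfne
    exact fun h' => h (h' p hp)
  have hreal : ∀ c : ℂ, MapClusterPt (c : OnePoint ℂ) (𝓝[UHP] (r : ℂ))
      (fun z => (ω z : OnePoint ℂ)) → ∃ x : ℝ, c = x := by
    intro c hc
    have hcl := cluster_coe hc
    rcases lt_trichotomy c.im 0 with h | h | h
    · exfalso
      obtain ⟨z, hz, -, hzc⟩ := hcl 1 one_pos (-c.im) (by linarith)
      have h1 : 0 < (ω z).im := hωU z hz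
      have h2 := (Complex.abs_im_le_norm (ω z - c)).trans_lt hzc
      rw [Complex.sub_im, abs_lt] at h2
      linarith
    · exact ⟨c.re, Complex.ext (by simp) (by simp [h])⟩
    · exfalso
      refine hcon c ?_
      exact (OnePoint.continuous_coe.tendsto c).comp
        (interior_cluster hf hfne hω hωU hfω h hcl)
  have hNB : (𝓝[UHP] (r : ℂ)).NeBot := by
    rw [← mem_closure_iff_nhdsWithin_neBot, Metric.mem_closure_iff]
    intro ε hε
    refine ⟨r + (ε / 2 : ℝ) * I, by simp [mem_UHP]; exact hε, ?_⟩
    rw [dist_eq_norm]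
    simp
    rw [abs_of_pos hε]; linarith
  obtain ⟨c₁, hc₁⟩ := exists_clusterPt_of_compactSpace
    (map (fun z => (ω z : OnePoint ℂ)) (𝓝[UHP] (r : ℂ)))
  have h2 : ∃ c₂, MapClusterPt c₂ (𝓝[UHP] (r : ℂ)) (fun z => (ω z : OnePoint ℂ)) ∧ c₂ ≠ c₁ := by
    by_contra h
    push Not at h
    exact hcon c₁ (le_nhds_of_unique_clusterPt h)
  obtain ⟨c₂, hc₂, hne⟩ := h2
  have hc₁' : MapClusterPt c₁ (𝓝[UHP] (r : ℂ)) (fun z => (ω z : OnePoint ℂ)) := hc₁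
  induction c₁ using OnePoint.rec with
  | infty =>
    induction c₂ using OnePoint.rec with
    | infty => exact hne rfl
    | coe c =>
      obtain ⟨x, rfl⟩ := hreal c hc₂
      exact hno (X_inf hf hB hω hωU hfω (cluster_coe hc₂) (cluster_inf hc₁'))
  | coe c =>
    obtain ⟨x, rfl⟩ := hreal c hc₁'
    induction c₂ using OnePoint.rec with
    | infty =>
      exact hno (X_inf hf hB hω hωU hfω (cluster_coe hc₁') (cluster_inf hc₂))
    | coe d =>
      obtain ⟨y, rfl⟩ := hreal d hc₂
      have hxy : x ≠ y := by
        rintro rfl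
        exact hne rfl
      rcases hxy.lt_or_gt with h | h
      · exact hno (X_reals hf hB hω hωU hfω h (cluster_coe hc₁') (cluster_coe hc₂))
      · exact hno (X_reals hf hB hω hωU hfω h (cluster_coe hc₂) (cluster_coe hc₁'))

/-- The complex plane minus the nonnegative axis. -/
def DD : Set ℂ := {z : ℂ | z.re < 0 ∨ z.im ≠ 0}

lemma mem_DD {z : ℂ} : z ∈ DD ↔ (z.re < 0 ∨ z.im ≠ 0) := Iff.rfl

lemma isOpen_DD : IsOpen DD := by
  have h1 : IsOpen {z : ℂ | z.re < 0} := isOpen_lt Complex.continuous_re continuous_const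
  have h2 : IsOpen {z : ℂ | z.im ≠ 0} := isOpen_ne_fun Complex.continuous_im continuous_const
  exact h1.union h2

lemma UHP_subset_DD : UHP ⊆ DD := fun _ hz => Or.inr (ne_of_gt hz)

lemma neg_mem_DD {x : ℝ} (hx : x < 0) : (x : ℂ) ∈ DD := Or.inl (by simpa using hx)

lemma kernel_bound {h : ℂ} (hh : h ∈ DD) :
    ∃ c > 0, ∃ δ > 0, ∀ h' ∈ Metric.ball h δ, ∀ t : ℝ,
      c * (1 + t ^ 2) ≤ ‖1 - h' * (t : ℂ) ^ 2‖ := by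
  have hcont : ContinuousOn (fun s : ℝ => ‖(s : ℂ) - h * (1 - s)‖) (Icc 0 1) := by fun_prop
  obtain ⟨s₀, hs₀, hmin⟩ := isCompact_Icc.exists_isMinOn (nonempty_Icc.2 zero_le_one) hcont
  have hpos : 0 < ‖(s₀ : ℂ) - h * (1 - s₀)‖ := by
    rw [norm_pos_iff]
    intro h0
    have hre := congrArg Complex.re h0
    have him := congrArg Complex.im h0
    simp at hre him
    rcases hh with h1 | h1
    · rcases hs₀.1.lt_or_eq with h2 | h2
      · nlinarith [mul_nonneg (neg_nonneg.2 h1.le) (sub_nonneg.2 hs₀.2)]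
      · rw [← h2] at hre
        simp at hre
        linarith
    · rcases him with h2 | h2
      · exact h1 h2
      · rw [h2] at hre
        have : s₀ = 1 := by linarith
        rw [this] at hre; simp at hre
  set m := ‖(s₀ : ℂ) - h * (1 - s₀)‖ with hm
  refine ⟨m / 2, by positivity, m / 2, by positivity, ?_⟩
  intro h' hh' t
  have ht : 0 < 1 + t ^ 2 := by positivity
  set s : ℝ := 1 / (1 + t ^ 2) with hs
  have hs0 : 0 ≤ s := by positivity
  have hs1 : s ≤ 1 := by rw [hs, div_le_one ht]; nlinarith [sq_nonneg t]
  have hmm : m ≤ ‖(s : ℂ) - h * (1 - s)‖ := hmin ⟨hs0, hs1⟩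
  have heq : (1 : ℂ) - h' * (t : ℂ) ^ 2 = ((1 + t ^ 2 : ℝ) : ℂ) * ((s : ℂ) - h' * (1 - s)) := by
    have ht' : ((1 + t ^ 2 : ℝ) : ℂ) ≠ 0 := by exact_mod_cast ht.ne'
    have : ((1 + t ^ 2 : ℝ) : ℂ) * s = 1 := by
      rw [← Complex.ofReal_mul, hs, mul_one_div_cancel ht.ne', Complex.ofReal_one]
    rw [mul_sub, this]
    have h2 : ((1 + t ^ 2 : ℝ) : ℂ) * (h' * (1 - s)) = h' * (((1 + t ^ 2 : ℝ) : ℂ) -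
        ((1 + t ^ 2 : ℝ) : ℂ) * s) := by ring
    rw [h2, this]
    push_cast; ring
  rw [heq, norm_mul, Complex.norm_real, Real.norm_of_nonneg ht.le]
  have h3 : ‖(s : ℂ) - h * (1 - s)‖ ≤ ‖(s : ℂ) - h' * (1 - s)‖ + ‖(h' - h) * (1 - s)‖ := by
    have : (s : ℂ) - h * (1 - s) = ((s : ℂ) - h' * (1 - s)) + (h' - h) * (1 - s) := by ring
    rw [this]; exact norm_add_le _ _
  have h4 : ‖(h' - h) * (1 - s)‖ ≤ m / 2 := by
    rw [norm_mul]
    have e1 : ‖(1 - s : ℂ)‖ ≤ 1 := by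
      rw [← Complex.ofReal_one, ← Complex.ofReal_sub, Complex.norm_real,
        Real.norm_of_nonneg (by linarith)]
      linarith
    have e2 : ‖h' - h‖ ≤ m / 2 := by
      have := hh'
      rw [Metric.mem_ball, dist_eq_norm] at this
      exact this.le
    calc ‖h' - h‖ * ‖(1 - s : ℂ)‖ ≤ m / 2 * 1 := by gcongr
      _ = m / 2 := mul_one _
  nlinarith

lemma kernel_ne {h : ℂ} (hh : h ∈ DD) (t : ℝ) : 1 - h * (t : ℂ) ^ 2 ≠ 0 := by
  obtain ⟨c, hc, δ, hδ, H⟩ := kernel_bound hh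
  have := H h (Metric.mem_ball_self hδ) t
  intro h0
  rw [h0, norm_zero] at this
  have : 0 < c * (1 + t ^ 2) := by positivity
  linarith

/-- The general kernel integral. -/
def KK (φ : ℝ → ℝ) (G : Measure ℝ) (h : ℂ) : ℂ :=
  ∫ t : ℝ, (φ t : ℂ) / (1 - h * (t : ℂ) ^ 2) ∂G

lemma kernel_le {φ : ℝ → ℝ} (hφ0 : ∀ t, 0 ≤ φ t) (hφ : ∀ t, φ t ≤ 1 + t ^ 2) {h' : ℂ} {c : ℝ}
    (hc : 0 < c) (t : ℝ) (hb : c * (1 + t ^ 2) ≤ ‖1 - h' * (t : ℂ) ^ 2‖) :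
    ‖(φ t : ℂ) / (1 - h' * (t : ℂ) ^ 2)‖ ≤ 1 / c := by
  have ht : 0 < 1 + t ^ 2 := by positivity
  have hp : 0 < c * (1 + t ^ 2) := by positivity
  rw [norm_div, Complex.norm_real, Real.norm_of_nonneg (hφ0 t),
    div_le_div_iff₀ (hp.trans_le hb) hc]
  nlinarith [hφ t]

lemma kernel_meas {φ : ℝ → ℝ} (hφm : Measurable φ) (G : Measure ℝ) (h : ℂ) :
    AEStronglyMeasurable (fun t : ℝ => (φ t : ℂ) / (1 - h * (t : ℂ) ^ 2)) G := by
  have : Measurable (fun t : ℝ => (φ t : ℂ) / (1 - h * (t : ℂ) ^ 2)) := by fun_prop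
  exact this.aestronglyMeasurable

lemma kernel_int {φ : ℝ → ℝ} (hφm : Measurable φ) (hφ0 : ∀ t, 0 ≤ φ t)
    (hφ : ∀ t, φ t ≤ 1 + t ^ 2) (G : Measure ℝ)
    [IsFiniteMeasure G] {h : ℂ} (hh : h ∈ DD) :
    Integrable (fun t : ℝ => (φ t : ℂ) / (1 - h * (t : ℂ) ^ 2)) G := by
  obtain ⟨c, hc, δ, hδ, H⟩ := kernel_bound hh
  refine Integrable.of_bound (kernel_meas hφm G h) (1 / c) (Eventually.of_forall fun t => ?_)
  exact kernel_le hφ0 hφ hc t (H h (Metric.mem_ball_self hδ) t)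

lemma KK_diff {φ : ℝ → ℝ} (hφm : Measurable φ) (hφ0 : ∀ t, 0 ≤ φ t)
    (hφ : ∀ t, φ t ≤ 1 + t ^ 2) (G : Measure ℝ)
    [IsFiniteMeasure G] {h : ℂ} (hh : h ∈ DD) : DifferentiableAt ℂ (KK φ G) h := by
  obtain ⟨c, hc, δ, hδ, H⟩ := kernel_bound hh
  have hpos : ∀ h' ∈ Metric.ball h δ, ∀ t : ℝ, 0 < ‖1 - h' * (t : ℂ) ^ 2‖ := by
    intro h' hh' t
    have : 0 < c * (1 + t ^ 2) := by positivity
    exact this.trans_le (H h' hh' t)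
  have key := hasDerivAt_integral_of_dominated_loc_of_deriv_le (μ := G) (𝕜 := ℂ)
    (F := fun h' t => (φ t : ℂ) / (1 - h' * (t : ℂ) ^ 2))
    (F' := fun h' t => (φ t : ℂ) / (1 - h' * (t : ℂ) ^ 2) * ((t : ℂ) ^ 2 / (1 - h' * (t : ℂ) ^ 2)))
    (bound := fun _ => 1 / c * (1 / c)) (x₀ := h)
    (Metric.ball_mem_nhds h hδ)
    (Eventually.of_forall fun h' => kernel_meas hφm G h')
    (kernel_int hφm hφ0 hφ G hh)
    (by
      have : Measurable (fun t : ℝ => (φ t : ℂ) / (1 - h * (t : ℂ) ^ 2) *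
        ((t : ℂ) ^ 2 / (1 - h * (t : ℂ) ^ 2))) := by fun_prop
      exact this.aestronglyMeasurable)
    (Eventually.of_forall fun t h' hh' => by
      rw [norm_mul]
      have h1 := kernel_le hφ0 hφ hc t (H h' hh' t)
      have h2 := kernel_le (φ := fun t => t ^ 2) (fun t => sq_nonneg t)
        (fun t => by linarith) hc t (H h' hh' t)
      rw [Complex.ofReal_pow] at h2
      gcongr)
    (integrable_const _)
    (Eventually.of_forall fun t h' hh' => by
      have h0 : 1 - h' * (t : ℂ) ^ 2 ≠ 0 := norm_pos_iff.1 (hpos h' hh' t)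
      have h1 : HasDerivAt (fun h' : ℂ => 1 - h' * (t : ℂ) ^ 2) (-(t : ℂ) ^ 2) h' := by
        simpa using ((hasDerivAt_id h').mul_const ((t : ℂ) ^ 2)).const_sub 1
      have := (hasDerivAt_const h' (φ t : ℂ)).div h1 h0
      refine this.congr_deriv ?_
      field_simp
      ring)
  exact key.2.differentiableAt

lemma KK_conj (φ : ℝ → ℝ) (G : Measure ℝ) (h : ℂ) :
    KK φ G ((starRingEnd ℂ) h) = (starRingEnd ℂ) (KK φ G h) := by
  unfold KK
  rw [← integral_conj]
  congr 1
  ext t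
  simp

lemma KK_real (φ : ℝ → ℝ) (G : Measure ℝ) (x : ℝ) :
    KK φ G (x : ℂ) = ((∫ t : ℝ, φ t / (1 - x * t ^ 2) ∂G : ℝ) : ℂ) := by
  unfold KK
  rw [← integral_complex_ofReal]
  congr 1
  ext t
  simp

lemma KK_im {φ : ℝ → ℝ} (hφm : Measurable φ) (hφ0 : ∀ t, 0 ≤ φ t)
    (hφ : ∀ t, φ t ≤ 1 + t ^ 2) (G : Measure ℝ)
    [IsFiniteMeasure G] {h : ℂ} (hh : h ∈ DD) (p : ℂ) :
    Integrable (fun t : ℝ => (p * ((φ t : ℂ) / (1 - h * (t : ℂ) ^ 2))).im) G ∧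
    (p * KK φ G h).im = ∫ t : ℝ, (p * ((φ t : ℂ) / (1 - h * (t : ℂ) ^ 2))).im ∂G := by
  have hi := (kernel_int hφm hφ0 hφ G hh).const_mul p
  refine ⟨hi.im, ?_⟩
  unfold KK
  rw [← integral_const_mul]
  exact (integral_im hi).symm

lemma kernel_im (p q : ℂ) (f t : ℝ) :
    (p * ((f : ℂ) / (1 - p * q * (t : ℂ) ^ 2))).im =
      f * (p.im + t ^ 2 * Complex.normSq p * q.im) / Complex.normSq (1 - p * q * (t : ℂ) ^ 2) := by
  rw [← mul_div_assoc, im_div_formula]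
  congr 1
  rw [← Complex.ofReal_pow]
  generalize t ^ 2 = s
  simp [Complex.normSq_apply]
  ring

lemma KK_im_nonneg {φ : ℝ → ℝ} (hφm : Measurable φ) (hφ0 : ∀ t, 0 ≤ φ t)
    (hφ : ∀ t, φ t ≤ 1 + t ^ 2) (G : Measure ℝ)
    [IsFiniteMeasure G] {p q : ℂ} (hpq : p * q ∈ DD) (hp : 0 ≤ p.im) (hq : 0 ≤ q.im) :
    0 ≤ (p * KK φ G (p * q)).im := by
  rw [(KK_im hφm hφ0 hφ G hpq p).2]
  refine integral_nonneg fun t => ?_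
  show 0 ≤ (p * ((φ t : ℂ) / (1 - p * q * (t : ℂ) ^ 2))).im
  rw [kernel_im]
  have := Complex.normSq_nonneg p
  have := Complex.normSq_nonneg (1 - p * q * (t : ℂ) ^ 2)
  have := hφ0 t
  positivity

lemma KK_im_pos {φ : ℝ → ℝ} (hφm : Measurable φ) (hφ0 : ∀ t, 0 < φ t)
    (hφ : ∀ t, φ t ≤ 1 + t ^ 2) (G : Measure ℝ)
    [IsFiniteMeasure G] (hG : G ≠ 0) {p q : ℂ} (hpq : p * q ∈ DD) (hp : 0 < p.im)
    (hq : 0 ≤ q.im) :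
    0 < (p * KK φ G (p * q)).im := by
  obtain ⟨h1, h2⟩ := KK_im hφm (fun t => (hφ0 t).le) hφ G hpq p
  have hpos : ∀ t : ℝ, 0 < (p * ((φ t : ℂ) / (1 - p * q * (t : ℂ) ^ 2))).im := by
    intro t
    rw [kernel_im]
    have := Complex.normSq_nonneg p
    have := Complex.normSq_pos.2 (kernel_ne hpq t)
    have := hφ0 t
    positivity
  rw [h2, integral_pos_iff_support_of_nonneg (fun t => (hpos t).le) h1]
  have : Function.support (fun t : ℝ => (p * ((φ t : ℂ) / (1 - p * q * (t : ℂ) ^ 2))).im)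
      = univ := by
    ext t
    simp only [Function.mem_support, mem_univ, iff_true]
    exact (hpos t).ne'
  rw [this]
  exact Measure.measure_univ_pos.2 hG

lemma Mt_eq (μ : Measure ℝ) [IsProbabilityMeasure μ] {z : ℂ} (hz : z ∈ DD) :
    1 + Mt μ z = KK (fun _ => 1) μ z := by
  have h1 := kernel_int (φ := fun _ => 1) measurable_const (fun _ => zero_le_one)
    (fun t => by nlinarith [sq_nonneg t]) μ hz
  have h2 : Mt μ z = ∫ t : ℝ, (((1 : ℝ) : ℂ) / (1 - z * (t : ℂ) ^ 2) - 1) ∂μ := by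
    unfold Mt
    congr 1
    ext t
    have := kernel_ne hz t
    field_simp
    simp
  rw [h2, integral_sub h1 (integrable_const _)]
  simp [KK]

lemma rectC_eq (G : Measure ℝ) (z : ℂ) : rectC G z = z * KK (fun t => 1 + t ^ 2) G z := by
  unfold rectC KK
  congr 2
  ext t
  simp

lemma Mt_diff (μ : Measure ℝ) [IsProbabilityMeasure μ] {z : ℂ} (hz : z ∈ DD) :
    DifferentiableAt ℂ (Mt μ) z := by
  have h1 := KK_diff (φ := fun _ => 1) measurable_const (fun _ => zero_le_one)
    (fun t => by nlinarith [sq_nonneg t]) μ hz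
  have h2 : Mt μ =ᶠ[𝓝 z] fun z => KK (fun _ => 1) μ z - 1 := by
    filter_upwards [isOpen_DD.mem_nhds hz] with w hw
    rw [← Mt_eq μ hw]; ring
  exact (h1.sub_const 1).congr_of_eventuallyEq h2

lemma Ht_diff (l : ℝ) (μ : Measure ℝ) [IsProbabilityMeasure μ] {z : ℂ} (hz : z ∈ DD) :
    DifferentiableAt ℂ (Ht l μ) z := by
  have := Mt_diff μ hz
  unfold Ht
  fun_prop

lemma rectC_diff (G : Measure ℝ) [IsFiniteMeasure G] {z : ℂ} (hz : z ∈ DD) :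
    DifferentiableAt ℂ (rectC G) z := by
  have h1 := KK_diff (φ := fun t => 1 + t ^ 2) (by fun_prop) (fun t => by positivity)
    (fun t => le_rfl) G hz
  have : rectC G = fun z => z * KK (fun t => 1 + t ^ 2) G z := funext (rectC_eq G)
  rw [this]
  exact differentiableAt_id.mul h1

lemma rectC_conj (G : Measure ℝ) (z : ℂ) :
    rectC G ((starRingEnd ℂ) z) = (starRingEnd ℂ) (rectC G z) := by
  rw [rectC_eq, rectC_eq, KK_conj, map_mul]

lemma Mt_conj (μ : Measure ℝ) (z : ℂ) :
    Mt μ ((starRingEnd ℂ) z) = (starRingEnd ℂ) (Mt μ z) := by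
  unfold Mt
  rw [← integral_conj]
  congr 1
  ext t
  simp

lemma Ht_conj (l : ℝ) (μ : Measure ℝ) (z : ℂ) :
    Ht l μ ((starRingEnd ℂ) z) = (starRingEnd ℂ) (Ht l μ z) := by
  unfold Ht
  simp [Mt_conj]

lemma mul_mem_DD {u v : ℂ} (hu : u ∈ UHP) (hv : 0 ≤ v.im) (hv0 : v ≠ 0) : u * v ∈ DD := by
  rw [mem_DD]
  by_contra hcon
  push Not at hcon
  obtain ⟨h1, h2⟩ := hcon
  have hu' : 0 < u.im := hu
  have h3 : u * v * (starRingEnd ℂ) v = u * (Complex.normSq v : ℂ) := by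
    rw [mul_assoc, Complex.mul_conj]
  have h4 := congrArg Complex.im h3
  rw [Complex.mul_im, h2] at h4
  simp only [Complex.conj_im, Complex.im_mul_ofReal, zero_mul, add_zero] at h4
  have := Complex.normSq_pos.2 hv0
  nlinarith [mul_pos hu' this, mul_nonneg h1 hv]

lemma F2 (μ : Measure ℝ) [IsProbabilityMeasure μ] {z : ℂ} (hz : z ∈ UHP) :
    0 < (z * (1 + Mt μ z)).im := by
  rw [Mt_eq μ (UHP_subset_DD hz)]
  have := KK_im_pos (φ := fun _ => 1) measurable_const (fun _ => zero_lt_one)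
    (fun t => by nlinarith [sq_nonneg t]) μ (IsProbabilityMeasure.ne_zero μ) (p := z) (q := 1)
    (by rw [mul_one]; exact UHP_subset_DD hz) hz (by simp)
  rwa [mul_one] at this

lemma F1 (μ : Measure ℝ) [IsProbabilityMeasure μ] {z : ℂ} (hz : z ∈ UHP) :
    0 ≤ (Mt μ z).im := by
  have := KK_im_nonneg (φ := fun _ => 1) measurable_const (fun _ => zero_le_one)
    (fun t => by nlinarith [sq_nonneg t]) μ (p := 1) (q := z)
    (by rw [one_mul]; exact UHP_subset_DD hz) (by simp) (le_of_lt hz)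
  rw [one_mul, one_mul, ← Mt_eq μ (UHP_subset_DD hz)] at this
  simpa using this

lemma F3 {l : ℝ} (hl : l ∈ Set.Ioo (0 : ℝ) 1) (μ : Measure ℝ) [IsProbabilityMeasure μ]
    {z : ℂ} (hz : z ∈ UHP) : 0 < (z * (1 + l * Mt μ z)).im := by
  have h1 := F2 μ hz
  have h2 : z * (1 + l * Mt μ z) = ((1 - l : ℝ) : ℂ) * z + (l : ℂ) * (z * (1 + Mt μ z)) := by
    push_cast; ring
  rw [h2, Complex.add_im, Complex.im_ofReal_mul, Complex.im_ofReal_mul]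
  exact add_pos (mul_pos (by linarith [hl.2]) hz) (mul_pos hl.1 h1)

lemma F4 (μ : Measure ℝ) [IsProbabilityMeasure μ] {z : ℂ} (hz : z ∈ UHP) :
    1 + Mt μ z ≠ 0 := by
  intro h
  have := F2 μ hz
  simp [h] at this

lemma F4' {l : ℝ} (hl : l ∈ Set.Ioo (0 : ℝ) 1) (μ : Measure ℝ) [IsProbabilityMeasure μ]
    {z : ℂ} (hz : z ∈ UHP) : 1 + l * Mt μ z ≠ 0 := by
  intro h
  have := F3 hl μ hz
  simp [h] at this

lemma F1a (μ : Measure ℝ) [IsProbabilityMeasure μ] {z : ℂ} (hz : z ∈ UHP) :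
    0 ≤ (1 + Mt μ z).im := by
  simpa using F1 μ hz

lemma F1b {l : ℝ} (hl : l ∈ Set.Ioo (0 : ℝ) 1) (μ : Measure ℝ) [IsProbabilityMeasure μ]
    {z : ℂ} (hz : z ∈ UHP) : 0 ≤ (1 + l * Mt μ z).im := by
  rw [Complex.add_im, Complex.im_ofReal_mul, Complex.one_im, zero_add]
  exact mul_nonneg hl.1.le (F1 μ hz)

lemma F5 {l : ℝ} (hl : l ∈ Set.Ioo (0 : ℝ) 1) (μ : Measure ℝ) [IsProbabilityMeasure μ]
    {z : ℂ} (hz : z ∈ UHP) : Ht l μ z ∈ DD :=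
  mul_mem_DD (F2 μ hz) (F1b hl μ hz) (F4' hl μ hz)

/-- The function `C(H)/(1+M)`. -/
def aF (l : ℝ) (G μ : Measure ℝ) (z : ℂ) : ℂ := rectC G (Ht l μ z) / (1 + Mt μ z)

/-- The function `C(H)/(1+lM)`. -/
def bF (l : ℝ) (G μ : Measure ℝ) (z : ℂ) : ℂ := rectC G (Ht l μ z) / (1 + l * Mt μ z)

/-- The subordination function. -/
def om (l : ℝ) (G ρ : Measure ℝ) (z : ℂ) : ℂ :=
  Ht l ρ z / Tfun l (Mt ρ z - rectC G (Ht l ρ z))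

lemma J_dich (G : Measure ℝ) [IsFiniteMeasure G] {p q : ℂ} (hp : p ∈ UHP) (hq : 0 ≤ q.im)
    (hq0 : q ≠ 0) :
    (rectC G (p * q) / q = 0 ∧ rectC G (p * q) = 0) ∨ 0 < (rectC G (p * q) / q).im := by
  have h1 : rectC G (p * q) / q = p * KK (fun t => 1 + t ^ 2) G (p * q) := by
    rw [rectC_eq]; field_simp
  rcases eq_or_ne G 0 with h | h
  · left
    have : rectC G (p * q) = 0 := by
      rw [rectC_eq, h]
      simp [KK]
    rw [this]; simp
  · right
    rw [h1]
    exact KK_im_pos (φ := fun t => 1 + t ^ 2) (by fun_prop) (fun t => by positivity)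
      (fun t => le_rfl) G h (mul_mem_DD hp hq hq0) hp hq

lemma aF_dich {l : ℝ} (hl : l ∈ Set.Ioo (0 : ℝ) 1) (G : Measure ℝ) [IsFiniteMeasure G]
    (μ : Measure ℝ) [IsProbabilityMeasure μ] {z : ℂ} (hz : z ∈ UHP) :
    (aF l G μ z = 0 ∧ rectC G (Ht l μ z) = 0) ∨ 0 < (aF l G μ z).im := by
  have h : Ht l μ z = (z * (1 + l * Mt μ z)) * (1 + Mt μ z) := by unfold Ht; ring
  unfold aF
  rw [h]
  exact J_dich G (F3 hl μ hz) (F1a μ hz) (F4 μ hz)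

lemma bF_dich {l : ℝ} (hl : l ∈ Set.Ioo (0 : ℝ) 1) (G : Measure ℝ) [IsFiniteMeasure G]
    (μ : Measure ℝ) [IsProbabilityMeasure μ] {z : ℂ} (hz : z ∈ UHP) :
    (bF l G μ z = 0 ∧ rectC G (Ht l μ z) = 0) ∨ 0 < (bF l G μ z).im := 
  J_dich G (F2 μ hz) (F1b hl μ hz) (F4' hl μ hz)

lemma aF_im {l : ℝ} (hl : l ∈ Set.Ioo (0 : ℝ) 1) (G : Measure ℝ) [IsFiniteMeasure G]
    (μ : Measure ℝ) [IsProbabilityMeasure μ] {z : ℂ} (hz : z ∈ UHP) : 0 ≤ (aF l G μ z).im := by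
  rcases aF_dich hl G μ hz with h | h
  · rw [h.1]; simp
  · exact h.le

lemma bF_im {l : ℝ} (hl : l ∈ Set.Ioo (0 : ℝ) 1) (G : Measure ℝ) [IsFiniteMeasure G]
    (μ : Measure ℝ) [IsProbabilityMeasure μ] {z : ℂ} (hz : z ∈ UHP) : 0 ≤ (bF l G μ z).im := by
  rcases bF_dich hl G μ hz with h | h
  · rw [h.1]; simp
  · exact h.le

lemma one_sub_aux {w : ℂ} {k : ℝ} (hk : 0 < k) (h : w = 0 ∨ 0 < w.im) :
    1 - (k : ℂ) * w ≠ 0 ∧ -Real.pi < (1 - (k : ℂ) * w).arg ∧ (1 - (k : ℂ) * w).arg ≤ 0 := by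
  rcases h with h | h
  · rw [h]
    simp [Real.pi_pos]
  · have him : (1 - (k : ℂ) * w).im < 0 := by
      rw [Complex.sub_im, Complex.im_ofReal_mul, Complex.one_im]
      have := mul_pos hk h
      linarith
    refine ⟨fun h0 => ?_, Complex.neg_pi_lt_arg _, (Complex.arg_neg_iff.2 him).le⟩
    rw [h0] at him; simp at him

lemma one_sub_a {l : ℝ} (hl : l ∈ Set.Ioo (0 : ℝ) 1) (G : Measure ℝ) [IsFiniteMeasure G]
    (μ : Measure ℝ) [IsProbabilityMeasure μ] {z : ℂ} (hz : z ∈ UHP) :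
    1 - aF l G μ z ≠ 0 ∧ -Real.pi < (1 - aF l G μ z).arg ∧ (1 - aF l G μ z).arg ≤ 0 := by
  have := one_sub_aux one_pos ((aF_dich hl G μ hz).imp_left And.left)
  simpa using this

lemma one_sub_b {l : ℝ} (hl : l ∈ Set.Ioo (0 : ℝ) 1) (G : Measure ℝ) [IsFiniteMeasure G]
    (μ : Measure ℝ) [IsProbabilityMeasure μ] {z : ℂ} (hz : z ∈ UHP) :
    1 - l * bF l G μ z ≠ 0 ∧ -Real.pi < (1 - l * bF l G μ z).arg ∧
      (1 - l * bF l G μ z).arg ≤ 0 :=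
  one_sub_aux hl.1 ((bF_dich hl G μ hz).imp_left And.left)

lemma P_eq {l : ℝ} (G μ : Measure ℝ) [IsProbabilityMeasure μ] {z : ℂ} (hz : z ∈ UHP) :
    1 + (Mt μ z - rectC G (Ht l μ z)) = (1 + Mt μ z) * (1 - aF l G μ z) := by
  have := F4 μ hz
  unfold aF
  field_simp
  ring

lemma Q_eq {l : ℝ} (hl : l ∈ Set.Ioo (0 : ℝ) 1) (G μ : Measure ℝ) [IsProbabilityMeasure μ]
    {z : ℂ} (hz : z ∈ UHP) :
    1 + l * (Mt μ z - rectC G (Ht l μ z)) = (1 + l * Mt μ z) * (1 - l * bF l G μ z) := by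
  have := F4' hl μ hz
  unfold bF
  field_simp
  ring

lemma T_ne {l : ℝ} (hl : l ∈ Set.Ioo (0 : ℝ) 1) (G : Measure ℝ) [IsFiniteMeasure G]
    (μ : Measure ℝ) [IsProbabilityMeasure μ] {z : ℂ} (hz : z ∈ UHP) :
    Tfun l (Mt μ z - rectC G (Ht l μ z)) ≠ 0 := by
  unfold Tfun
  rw [add_comm _ (1 : ℂ), add_comm _ (1 : ℂ), P_eq G μ hz, Q_eq hl G μ hz]
  exact mul_ne_zero (mul_ne_zero (F4' hl μ hz) (one_sub_b hl G μ hz).1)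
    (mul_ne_zero (F4 μ hz) (one_sub_a hl G μ hz).1)

lemma om_eq {l : ℝ} (hl : l ∈ Set.Ioo (0 : ℝ) 1) (G : Measure ℝ) [IsFiniteMeasure G]
    (μ : Measure ℝ) [IsProbabilityMeasure μ] {z : ℂ} (hz : z ∈ UHP) :
    om l G μ z * ((1 - aF l G μ z) * (1 - l * bF l G μ z)) = z := by
  have h1 := F4' hl μ hz
  have h2 := F4 μ hz
  have h3 := (one_sub_a hl G μ hz).1
  have h4 := (one_sub_b hl G μ hz).1
  unfold om Tfun
  rw [add_comm _ (1 : ℂ), add_comm _ (1 : ℂ), P_eq G μ hz, Q_eq hl G μ hz]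
  generalize aF l G μ z = a at *
  generalize bF l G μ z = b at *
  unfold Ht
  rw [div_mul_eq_mul_div, div_eq_iff (mul_ne_zero (mul_ne_zero h1 h4) (mul_ne_zero h2 h3))]
  ring

lemma om_diff {l : ℝ} (G : Measure ℝ) [IsFiniteMeasure G]
    (μ : Measure ℝ) [IsProbabilityMeasure μ] {z : ℂ} (hz : z ∈ DD) (hH : Ht l μ z ∈ DD)
    (hT : Tfun l (Mt μ z - rectC G (Ht l μ z)) ≠ 0) : DifferentiableAt ℂ (om l G μ) z := by
  have h1 := Ht_diff l μ hz
  have h2 := Mt_diff μ hz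
  have h3 : DifferentiableAt ℂ (fun z => rectC G (Ht l μ z)) z :=
    (rectC_diff G hH).comp z h1
  unfold om
  refine h1.div ?_ hT
  unfold Tfun
  fun_prop

lemma aF_diff {l : ℝ} (hl : l ∈ Set.Ioo (0 : ℝ) 1) (G : Measure ℝ) [IsFiniteMeasure G]
    (μ : Measure ℝ) [IsProbabilityMeasure μ] {z : ℂ} (hz : z ∈ UHP) :
    DifferentiableAt ℂ (aF l G μ) z ∧ DifferentiableAt ℂ (bF l G μ) z := by
  have h1 := Ht_diff l μ (UHP_subset_DD hz)
  have h2 := Mt_diff μ (UHP_subset_DD hz)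
  have h3 : DifferentiableAt ℂ (fun z => rectC G (Ht l μ z)) z :=
    (rectC_diff G (F5 hl μ hz)).comp z h1
  exact ⟨h3.div (h2.const_add 1) (F4 μ hz),
    h3.div ((h2.const_mul _).const_add 1) (F4' hl μ hz)⟩

/-- Consequences of the subordination identity at one point. -/
lemma sub_point {l : ℝ} (hl : l ∈ Set.Ioo (0 : ℝ) 1) (G : Measure ℝ) [IsFiniteMeasure G]
    (ν ρ : Measure ℝ) [IsProbabilityMeasure ρ] {z : ℂ} (hz : z ∈ UHP)
    (hI : Mt ν (om l G ρ z) = Mt ρ z - rectC G (Ht l ρ z)) :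
    Ht l ν (om l G ρ z) = Ht l ρ z ∧
    (1 + aF l G ν (om l G ρ z)) * (1 - aF l G ρ z) = 1 ∧
    (1 + l * bF l G ν (om l G ρ z)) * (1 - l * bF l G ρ z) = 1 := by
  have hT := T_ne hl G ρ hz
  have hH : Ht l ν (om l G ρ z) = Ht l ρ z := by
    have : Ht l ν (om l G ρ z) = om l G ρ z * Tfun l (Mt ν (om l G ρ z)) := by
      unfold Ht Tfun; ring
    rw [this, hI]
    unfold om
    field_simp
  have h1 := F4' hl ρ hz
  have h2 := F4 ρ hz
  have h3 := (one_sub_a hl G ρ hz).1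
  have h4 := (one_sub_b hl G ρ hz).1
  refine ⟨hH, ?_, ?_⟩
  · have e : aF l G ν (om l G ρ z) = aF l G ρ z / (1 - aF l G ρ z) := by
      rw [aF, hH, hI, P_eq G ρ hz]
      rw [← div_div]
      rfl
    rw [e]
    field_simp
    ring
  · have e : bF l G ν (om l G ρ z) = bF l G ρ z / (1 - l * bF l G ρ z) := by
      rw [bF, hH, hI, Q_eq hl G ρ hz]
      rw [← div_div]
      rfl
    rw [e]
    field_simp
    ring

lemma sub_UHP {l : ℝ} (hl : l ∈ Set.Ioo (0 : ℝ) 1) (G : Measure ℝ) [IsFiniteMeasure G]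
    (ν ρ : Measure ℝ) [IsProbabilityMeasure ν] [IsProbabilityMeasure ρ] {z : ℂ} (hz : z ∈ UHP)
    (hI : Mt ν (om l G ρ z) = Mt ρ z - rectC G (Ht l ρ z)) : om l G ρ z ∈ UHP := by
  obtain ⟨-, ha, -⟩ := sub_point hl G ν ρ hz hI
  by_contra hcon
  have him : (om l G ρ z).im ≤ 0 := not_lt.1 hcon
  have h3 := (one_sub_a hl G ρ hz).1
  have hconj : ∀ w, aF l G ν ((starRingEnd ℂ) w) = (starRingEnd ℂ) (aF l G ν w) := by
    intro w
    simp [aF, Ht_conj, rectC_conj, Mt_conj]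
  have h5 : (aF l G ν (om l G ρ z)).im ≤ 0 := by
    rcases him.lt_or_eq with h | h
    · have hc : (starRingEnd ℂ) (om l G ρ z) ∈ UHP := by
        rw [mem_UHP, Complex.conj_im]; linarith
      have := aF_im hl G ν hc
      rw [hconj, Complex.conj_im] at this
      linarith
    · have hc : (starRingEnd ℂ) (om l G ρ z) = om l G ρ z := Complex.conj_eq_iff_im.2 h
      have := hconj (om l G ρ z)
      rw [hc] at this
      exact (Complex.conj_eq_iff_im.1 this.symm).le
  have h6 : 1 + aF l G ν (om l G ρ z) = 1 / (1 - aF l G ρ z) := by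
    rw [eq_div_iff h3, ha]
  have h7 : (1 + aF l G ν (om l G ρ z)).im = (aF l G ρ z).im / Complex.normSq (1 - aF l G ρ z) := by
    rw [h6, im_div_formula]
    simp
  have h8 : (1 + aF l G ν (om l G ρ z)).im ≤ 0 := by simpa using h5
  rcases aF_dich hl G ρ hz with h | h
  · have h9 := om_eq hl G ρ hz
    rw [h.1] at h9
    have h10 : bF l G ρ z = 0 := by rw [bF, h.2, zero_div]
    rw [h10] at h9
    simp at h9
    rw [h9] at hcon
    exact hcon hz
  · have := div_pos h (Complex.normSq_pos.2 h3)
    linarith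

lemma Mt_neg (μ : Measure ℝ) [IsProbabilityMeasure μ] {x : ℝ} (hx : x < 0) :
    ∃ m : ℝ, -1 < m ∧ Mt μ (x : ℂ) = m := by
  have h1 := Mt_eq μ (neg_mem_DD hx)
  rw [KK_real] at h1
  have hi := kernel_int (φ := fun _ => 1) measurable_const (fun _ => zero_le_one)
    (fun t => by nlinarith [sq_nonneg t]) μ (neg_mem_DD hx)
  have hpos : ∀ t : ℝ, 0 < 1 / (1 - x * t ^ 2) := by
    intro t
    have : 0 < 1 - x * t ^ 2 := by nlinarith [mul_nonneg (neg_nonneg.2 hx.le) (sq_nonneg t)]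
    positivity
  have hi' : Integrable (fun t : ℝ => 1 / (1 - x * t ^ 2)) μ := by
    have := hi.re
    refine this.congr (Eventually.of_forall fun t => ?_)
    have e : (((1 : ℝ) : ℂ) / (1 - (x : ℂ) * (t : ℂ) ^ 2)) = ((1 / (1 - x * t ^ 2) : ℝ) : ℂ) := by
      push_cast; rfl
    show (((1 : ℝ) : ℂ) / (1 - (x : ℂ) * (t : ℂ) ^ 2)).re = _
    rw [e, Complex.ofReal_re]
  have hp : 0 < ∫ t : ℝ, 1 / (1 - x * t ^ 2) ∂μ := by
    rw [integral_pos_iff_support_of_nonneg (fun t => (hpos t).le) hi']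
    have : Function.support (fun t : ℝ => 1 / (1 - x * t ^ 2)) = univ := by
      ext t
      simp only [Function.mem_support, mem_univ, iff_true]
      exact (hpos t).ne'
    rw [this]
    exact Measure.measure_univ_pos.2 (IsProbabilityMeasure.ne_zero μ)
  refine ⟨(∫ t : ℝ, 1 / (1 - x * t ^ 2) ∂μ) - 1, by linarith, ?_⟩
  rw [Complex.ofReal_sub, ← h1]
  simp

lemma rectC_neg (G : Measure ℝ) {x : ℝ} (hx : x < 0) :
    ∃ c : ℝ, c ≤ 0 ∧ rectC G (x : ℂ) = c := by
  rw [rectC_eq, KK_real]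
  refine ⟨x * ∫ t : ℝ, (1 + t ^ 2) / (1 - x * t ^ 2) ∂G, ?_, by push_cast; rfl⟩
  refine mul_nonpos_of_nonpos_of_nonneg hx.le (integral_nonneg fun t => ?_)
  have : 0 < 1 - x * t ^ 2 := by nlinarith [mul_nonneg (neg_nonneg.2 hx.le) (sq_nonneg t)]
  show 0 ≤ (1 + t ^ 2) / (1 - x * t ^ 2)
  positivity

lemma lin_pos {l m : ℝ} (hl : l ∈ Set.Ioo (0 : ℝ) 1) (hm : -1 < m) : 0 < 1 + l * m := by
  nlinarith [hl.1, hl.2, mul_pos hl.1 (by linarith : 0 < m + 1)]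

lemma Ht_neg {l : ℝ} (hl : l ∈ Set.Ioo (0 : ℝ) 1) (μ : Measure ℝ) [IsProbabilityMeasure μ]
    {x : ℝ} (hx : x < 0) : ∃ h : ℝ, h < 0 ∧ Ht l μ (x : ℂ) = h := by
  obtain ⟨m, hm, e⟩ := Mt_neg μ hx
  refine ⟨x * (1 + m) * (1 + l * m), ?_, by rw [Ht, e]; push_cast; ring⟩
  have h1 : 0 < 1 + m := by linarith
  exact mul_neg_of_neg_of_pos (mul_neg_of_neg_of_pos hx h1) (lin_pos hl hm)

/-- The subordination identity on the negative axis. -/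
lemma neg_axis {l : ℝ} (hl : l ∈ Set.Ioo (0 : ℝ) 1) (G : Measure ℝ)
    (ν ρ : Measure ℝ) [IsProbabilityMeasure ν] [IsProbabilityMeasure ρ] {x : ℝ} (hx : x < 0)
    (h : Ht l ρ (x : ℂ) =
      Ht l ν (Ht l ρ (x : ℂ) / Tfun l (Mt ρ (x : ℂ) - rectC G (Ht l ρ (x : ℂ))))) :
    Ht l ρ (x : ℂ) ∈ DD ∧ om l G ρ x ∈ DD ∧
      Mt ν (om l G ρ x) = Mt ρ x - rectC G (Ht l ρ x) := by
  obtain ⟨m, hm, em⟩ := Mt_neg ρ hx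
  obtain ⟨k, hk, ek⟩ := Ht_neg hl ρ hx
  obtain ⟨c, hc, ec⟩ := rectC_neg G hk
  have hmc : -1 < m - c := by linarith
  have hT : 0 < (l * (m - c) + 1) * ((m - c) + 1) :=
    mul_pos (by linarith [lin_pos hl hmc]) (by linarith)
  have hw : k / ((l * (m - c) + 1) * ((m - c) + 1)) < 0 := div_neg_of_neg_of_pos hk hT
  have eom : om l G ρ x = ((k / ((l * (m - c) + 1) * ((m - c) + 1)) : ℝ) : ℂ) := by
    rw [om, ek, ec, em, Tfun]
    push_cast
    rfl
  obtain ⟨n, hn, en⟩ := Mt_neg ν hw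
  have h' : Ht l ρ (x : ℂ) = Ht l ν (om l G ρ x) := h
  refine ⟨by rw [ek]; exact neg_mem_DD hk, by rw [eom]; exact neg_mem_DD hw, ?_⟩
  rw [eom, ek, Ht, en] at h'
  rw [eom, en, ek, ec, em]
  have h2 : k = k / ((l * (m - c) + 1) * ((m - c) + 1)) * (1 + n) * (1 + l * n) := by
    exact_mod_cast h'
  have h3 : (l * (m - c) + 1) * ((m - c) + 1) = (1 + n) * (1 + l * n) := by
    have hk0 := hk.ne
    have hT0 := hT.ne'
    generalize (l * (m - c) + 1) * ((m - c) + 1) = T at *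
    field_simp at h2
    rw [h2]; ring
  have h4 : n = m - c := by
    have h5 : (n - (m - c)) * ((l * (m - c) + 1) + (l * n + 1) - (1 - (l : ℝ))) = 0 := by
      nlinarith
    rcases mul_eq_zero.1 h5 with h6 | h6
    · linarith
    · exfalso
      have e1 : 0 < l * ((m - c) + 1) := mul_pos hl.1 (by linarith)
      have e2 : 0 < l * (n + 1) := mul_pos hl.1 (by linarith)
      nlinarith [hl.2]
  rw [h4]
  push_cast; rfl

/-- The argument estimate excluding positive boundary values. -/
lemma no_pos {z p q A B : ℂ} {w : ℝ} (hz : 0 < z.im) (hp : 0 ≤ p.im) (hq : 0 ≤ q.im)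
    (hp0 : p ≠ 0) (hq0 : q ≠ 0) (hzp : 0 < (z * p).im)
    (hA : A ≠ 0 ∧ -Real.pi < A.arg ∧ A.arg ≤ 0) (hB : B ≠ 0 ∧ -Real.pi < B.arg ∧ B.arg ≤ 0)
    (hP : 0 ≤ (p * A).im) (hQ : 0 ≤ (q * B).im) (hw : 0 < w) (h : (w : ℂ) * (A * B) = z) :
    False := by
  have hz0 := ne_zero_of_UHP (z := z) hz
  have hza := arg_mem_of_UHP (z := z) hz
  have hpa := Complex.arg_nonneg_iff.2 hp
  have hqa := Complex.arg_nonneg_iff.2 hq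
  have hpa' := Complex.arg_le_pi p
  have hqa' := Complex.arg_le_pi q
  have h1 : (p * A).arg = p.arg + A.arg :=
    Complex.arg_mul hp0 hA.1 ⟨by linarith, by linarith⟩
  have h2 : (q * B).arg = q.arg + B.arg :=
    Complex.arg_mul hq0 hB.1 ⟨by linarith, by linarith⟩
  have h3 := Complex.arg_nonneg_iff.2 hP
  have h4 := Complex.arg_nonneg_iff.2 hQ
  have h5 : z.arg + p.arg < Real.pi := by
    by_contra hcon
    push Not at hcon
    have e1 : z * p = ((‖z‖ * ‖p‖ : ℝ) : ℂ) * Complex.exp (((z.arg + p.arg : ℝ) : ℂ) * I) := by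
      conv_lhs => rw [← Complex.norm_mul_exp_arg_mul_I z, ← Complex.norm_mul_exp_arg_mul_I p]
      push_cast
      rw [add_mul, Complex.exp_add]
      ring
    rw [e1, Complex.im_ofReal_mul, Complex.exp_ofReal_mul_I_im] at hzp
    have e2 : Real.sin (z.arg + p.arg) ≤ 0 := by
      have := Real.sin_nonneg_of_nonneg_of_le_pi (x := z.arg + p.arg - Real.pi)
        (by linarith) (by linarith [hza.2])
      rw [Real.sin_sub_pi] at this
      linarith
    have := mul_nonneg (norm_nonneg z) (norm_nonneg p)
    nlinarith
  have hAB : A * B ≠ 0 := mul_ne_zero hA.1 hB.1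
  have h6 : (z.arg : Real.Angle) = ((A.arg + B.arg : ℝ) : Real.Angle) := by
    rw [← h, Complex.arg_real_mul _ hw, Complex.arg_mul_coe_angle hA.1 hB.1, Real.Angle.coe_add]
  obtain ⟨k, hk⟩ := Real.Angle.angle_eq_iff_two_pi_dvd_sub.1 h6
  have hpi := Real.pi_pos
  have b1 : 0 < 2 * Real.pi * (k : ℝ) := by rw [← hk]; linarith [hza.1, hA.2.2, hB.2.2]
  have b2 : 2 * Real.pi * (k : ℝ) < 2 * Real.pi := by rw [← hk]; linarith
  have c1 : (0 : ℝ) < k := by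
    by_contra hc
    push Not at hc
    nlinarith
  have c2 : (k : ℝ) < 1 := by nlinarith
  have d1 : 0 < k := by exact_mod_cast c1
  have d2 : k < 1 := by exact_mod_cast c2
  omega

/-- Difference of the two sides of the subordination identity. -/
def FF (l : ℝ) (G ν ρ : Measure ℝ) (z : ℂ) : ℂ :=
  Mt ν (om l G ρ z) - (Mt ρ z - rectC G (Ht l ρ z))

lemma FF_analytic {l : ℝ} (G : Measure ℝ) [IsFiniteMeasure G]
    (ν ρ : Measure ℝ) [IsProbabilityMeasure ν] [IsProbabilityMeasure ρ] {z : ℂ} (hz : z ∈ DD)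
    (hH : Ht l ρ z ∈ DD) (hT : Tfun l (Mt ρ z - rectC G (Ht l ρ z)) ≠ 0)
    (hw : om l G ρ z ∈ DD) : AnalyticAt ℂ (FF l G ν ρ) z := by
  rw [Complex.analyticAt_iff_eventually_differentiableAt]
  have c1 : ContinuousAt (Ht l ρ) z := (Ht_diff l ρ hz).continuousAt
  have c2 : ContinuousAt (om l G ρ) z := (om_diff G ρ hz hH hT).continuousAt
  have c3 : ContinuousAt (fun z => Tfun l (Mt ρ z - rectC G (Ht l ρ z))) z := by
    have h1 := (Mt_diff ρ hz).continuousAt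
    have h3 : ContinuousAt (fun z => rectC G (Ht l ρ z)) z :=
      ((rectC_diff G hH).comp z (Ht_diff l ρ hz)).continuousAt
    unfold Tfun
    fun_prop
  filter_upwards [isOpen_DD.mem_nhds hz, c1.preimage_mem_nhds (isOpen_DD.mem_nhds hH),
    c2.preimage_mem_nhds (isOpen_DD.mem_nhds hw), c3.eventually_ne hT] with u hu hHu hwu hTu
  have d1 : DifferentiableAt ℂ (fun z => Mt ν (om l G ρ z)) u :=
    DifferentiableAt.comp (g := Mt ν) u (Mt_diff ν hwu) (om_diff G ρ hu hHu hTu)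
  have d2 : DifferentiableAt ℂ (fun z => rectC G (Ht l ρ z)) u :=
    DifferentiableAt.comp (g := rectC G) u (rectC_diff G hHu) (Ht_diff l ρ hu)
  exact d1.sub ((Mt_diff ρ hu).sub d2)

lemma om_diff_UHP {l : ℝ} (hl : l ∈ Set.Ioo (0 : ℝ) 1) (G : Measure ℝ) [IsFiniteMeasure G]
    (ρ : Measure ℝ) [IsProbabilityMeasure ρ] {z : ℂ} (hz : z ∈ UHP) :
    DifferentiableAt ℂ (om l G ρ) z :=
  om_diff G ρ (UHP_subset_DD hz) (F5 hl ρ hz) (T_ne hl G ρ hz)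

lemma start_point {l : ℝ} (hl : l ∈ Set.Ioo (0 : ℝ) 1) (G : Measure ℝ) [IsFiniteMeasure G]
    (ν ρ : Measure ℝ) [IsProbabilityMeasure ν] [IsProbabilityMeasure ρ]
    (hconv : IsRectConv l G ν ρ) : ∃ z ∈ UHP, ∀ᶠ z' in 𝓝 z, FF l G ν ρ z' = 0 := by
  obtain ⟨ε, hε, hc⟩ := hconv
  have hx0 : (-(ε / 2)) ∈ Set.Ioo (-ε) 0 := ⟨by linarith, by linarith⟩
  set x₀ : ℝ := -(ε / 2) with hx₀
  obtain ⟨hT, hH⟩ := hc x₀ hx0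
  obtain ⟨h1, h2, h3⟩ := neg_axis hl G ν ρ hx0.2 hH
  have hA := FF_analytic G ν ρ (neg_mem_DD hx0.2) h1 hT h2
  have hev : ∀ᶠ z in 𝓝 (x₀ : ℂ), FF l G ν ρ z = 0 := by
    rcases hA.eventually_eq_zero_or_eventually_ne_zero with h | h
    · exact h
    · exfalso
      have ht : Tendsto (fun x : ℝ => (x : ℂ)) (𝓝[≠] x₀) (𝓝[≠] (x₀ : ℂ)) := by
        refine tendsto_nhdsWithin_iff.2 ⟨?_, ?_⟩
        · exact (Complex.continuous_ofReal.tendsto x₀).mono_left nhdsWithin_le_nhds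
        · filter_upwards [self_mem_nhdsWithin] with x hx
          simpa using hx
      have h5 := ht.eventually h
      have h6 : ∀ᶠ x in 𝓝[≠] x₀, x ∈ Set.Ioo (-ε) 0 :=
        mem_nhdsWithin_of_mem_nhds (Ioo_mem_nhds hx0.1 hx0.2)
      obtain ⟨x, hx, hxm⟩ := (h5.and h6).exists
      apply hx
      have := (neg_axis hl G ν ρ hxm.2 (hc x hxm).2).2.2
      unfold FF
      rw [this, sub_self]
  have hcl : (x₀ : ℂ) ∈ closure UHP := by
    rw [Metric.mem_closure_iff]
    intro e he
    refine ⟨x₀ + (e / 2 : ℝ) * I, by simp [mem_UHP]; exact he, ?_⟩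
    rw [dist_eq_norm]
    simp
    rw [abs_of_pos he]; linarith
  rw [mem_closure_iff_nhdsWithin_neBot] at hcl
  have := (eventually_nhdsWithin_of_eventually_nhds (s := UHP)
    (eventually_eventually_nhds.2 hev)).and self_mem_nhdsWithin
  obtain ⟨z, hz, hzU⟩ := this.exists
  exact ⟨z, hzU, hz⟩

lemma subord_all {l : ℝ} (hl : l ∈ Set.Ioo (0 : ℝ) 1) (G : Measure ℝ) [IsFiniteMeasure G]
    (ν ρ : Measure ℝ) [IsProbabilityMeasure ν] [IsProbabilityMeasure ρ]
    (hconv : IsRectConv l G ν ρ) {z : ℂ} (hz : z ∈ UHP) :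
    om l G ρ z ∈ UHP ∧ Mt ν (om l G ρ z) = Mt ρ z - rectC G (Ht l ρ z) := by
  set S : Set ℂ := {z | ∀ᶠ z' in 𝓝 z, FF l G ν ρ z' = 0} with hS
  have hSo : IsOpen S := isOpen_iff_mem_nhds.2 fun z hz => eventually_eventually_nhds.2 hz
  have hS0 : ∀ z ∈ S, FF l G ν ρ z = 0 := fun z hz =>
    Eventually.self_of_nhds (p := fun z' => FF l G ν ρ z' = 0) hz
  have hSI : ∀ z ∈ S, Mt ν (om l G ρ z) = Mt ρ z - rectC G (Ht l ρ z) := fun z hz =>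
    sub_eq_zero.1 (hS0 z hz)
  have hsub : UHP ⊆ S := by
    refine convex_UHP.isPreconnected.subset_of_closure_inter_subset hSo ?_ ?_
    · obtain ⟨z, hz, h⟩ := start_point hl G ν ρ hconv
      exact ⟨z, hz, h⟩
    · rintro z₀ ⟨hcl, hz₀⟩
      by_contra hnot
      have hcl2 : z₀ ∈ closure (UHP ∩ S) := by
        have := isOpen_UHP.inter_closure (t := S) ⟨hz₀, hcl⟩
        exact this
      rw [mem_closure_iff_nhdsWithin_neBot] at hcl2
      have hom : ContinuousAt (om l G ρ) z₀ := (om_diff_UHP hl G ρ hz₀).continuousAt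
      have hmd : ContinuousAt (fun z => Mt ρ z - rectC G (Ht l ρ z)) z₀ :=
        ((Mt_diff ρ (UHP_subset_DD hz₀)).sub (DifferentiableAt.comp (g := rectC G) z₀
          (rectC_diff G (F5 hl ρ hz₀)) (Ht_diff l ρ (UHP_subset_DD hz₀)))).continuousAt
      have i1 : 0 ≤ (om l G ρ z₀).im := by
        refine ge_of_tendsto (x := 𝓝[UHP ∩ S] z₀) (f := fun z => (om l G ρ z).im)
          ((Complex.continuous_im.tendsto _).comp (hom.tendsto.mono_left nhdsWithin_le_nhds)) ?_
        filter_upwards [self_mem_nhdsWithin] with z hz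
        exact le_of_lt (sub_UHP hl G ν ρ hz.1 (hSI z hz.2))
      have i2 : 0 ≤ (Mt ρ z₀ - rectC G (Ht l ρ z₀)).im := by
        refine ge_of_tendsto (x := 𝓝[UHP ∩ S] z₀)
          (f := fun z => (Mt ρ z - rectC G (Ht l ρ z)).im)
          ((Complex.continuous_im.tendsto _).comp (hmd.tendsto.mono_left nhdsWithin_le_nhds)) ?_
        filter_upwards [self_mem_nhdsWithin] with z hz
        rw [← hSI z hz.2]
        exact F1 ν (sub_UHP hl G ν ρ hz.1 (hSI z hz.2))
      have hDD : om l G ρ z₀ ∈ DD := by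
        rw [mem_DD]
        by_contra hcon
        push Not at hcon
        obtain ⟨hre, him⟩ := hcon
        have hoeq := om_eq hl G ρ hz₀
        have hreal : om l G ρ z₀ = ((om l G ρ z₀).re : ℂ) :=
          Complex.ext (by simp) (by simp [him])
        have hpos : 0 < (om l G ρ z₀).re := by
          rcases hre.lt_or_eq with h | h
          · exact h
          · exfalso
            rw [hreal, ← h] at hoeq
            simp at hoeq
            exact ne_zero_of_UHP hz₀ hoeq.symm
        rw [hreal] at hoeq
        refine no_pos (z := z₀) hz₀ (F1a ρ hz₀) (F1b hl ρ hz₀) (F4 ρ hz₀) (F4' hl ρ hz₀)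
          (F2 ρ hz₀) (one_sub_a hl G ρ hz₀) (one_sub_b hl G ρ hz₀) ?_ ?_ hpos hoeq
        · rw [← P_eq G ρ hz₀, Complex.add_im, Complex.one_im, zero_add]
          exact i2
        · rw [← Q_eq hl G ρ hz₀, Complex.add_im, Complex.one_im, zero_add, Complex.im_ofReal_mul]
          exact mul_nonneg hl.1.le i2
      have hA := FF_analytic G ν ρ (UHP_subset_DD hz₀) (F5 hl ρ hz₀) (T_ne hl G ρ hz₀) hDD
      rcases hA.eventually_eq_zero_or_eventually_ne_zero with h | h
      · exact hnot h
      · rw [eventually_nhdsWithin_iff] at h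
        obtain ⟨z, hz, hzS⟩ := ((eventually_nhdsWithin_of_eventually_nhds (s := UHP ∩ S) h).and
          self_mem_nhdsWithin).exists
        refine hz ?_ (hS0 z hzS.2)
        rintro rfl
        exact hnot hzS.2
  have hI := hSI z (hsub hz)
  exact ⟨sub_UHP hl G ν ρ hz hI, hI⟩

lemma norm_le_add_I {A : ℂ} (hA : 0 ≤ A.im) : ‖A‖ ≤ ‖A + I‖ ∧ 1 ≤ ‖A + I‖ := by
  constructor
  · rw [Complex.norm_def, Complex.norm_def]
    refine Real.sqrt_le_sqrt ?_
    rw [Complex.normSq_apply, Complex.normSq_apply]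
    simp
    nlinarith
  · refine le_trans ?_ (Complex.abs_im_le_norm _)
    simp
    rw [abs_of_nonneg (by linarith)]
    linarith

theorem main_limit {l : ℝ} (hl : l ∈ Set.Ioo (0 : ℝ) 1) (G : Measure ℝ) [IsFiniteMeasure G]
    (ν ρ : Measure ℝ) [IsProbabilityMeasure ν] [IsProbabilityMeasure ρ]
    (hconv : IsRectConv l G ν ρ) (r : ℝ) :
    ∃ L : OnePoint ℂ, Tendsto (fun z => (om l G ρ z : OnePoint ℂ)) (𝓝[UHP] (r : ℂ)) (𝓝 L) := by
  have hA : ∀ w ∈ UHP, 0 ≤ (1 + aF l G ν w).im := fun w hw => by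
    simpa using aF_im hl G ν hw
  have hB : ∀ w ∈ UHP, 0 ≤ (1 + l * bF l G ν w).im := fun w hw => by
    rw [Complex.add_im, Complex.im_ofReal_mul, Complex.one_im, zero_add]
    exact mul_nonneg hl.1.le (bF_im hl G ν hw)
  have hd : ∀ w ∈ UHP, ((w + I) * (1 + aF l G ν w + I) * (1 + l * bF l G ν w + I)) ≠ 0 := by
    intro w hw
    have e : ∀ A : ℂ, 0 ≤ A.im → A + I ≠ 0 := fun A hA h => by
      have := (norm_le_add_I hA).2
      rw [h] at this; simp at this
      linarith
    exact mul_ne_zero (mul_ne_zero (e _ (le_of_lt hw)) (e _ (hA w hw))) (e _ (hB w hw))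
  have hkey : ∀ z ∈ UHP, om l G ρ z =
      z * (1 + aF l G ν (om l G ρ z)) * (1 + l * bF l G ν (om l G ρ z)) ∧
      (1 + aF l G ν (om l G ρ z)) ≠ 0 ∧ (1 + l * bF l G ν (om l G ρ z)) ≠ 0 := by
    intro z hz
    obtain ⟨-, h1, h2⟩ := sub_point hl G ν ρ hz (subord_all hl G ν ρ hconv hz).2
    refine ⟨?_, left_ne_zero_of_mul_eq_one h1, left_ne_zero_of_mul_eq_one h2⟩
    have h3 := om_eq hl G ρ hz
    calc om l G ρ z = om l G ρ z * (((1 + aF l G ν (om l G ρ z)) * (1 - aF l G ρ z)) *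
          ((1 + l * bF l G ν (om l G ρ z)) * (1 - l * bF l G ρ z))) := by rw [h1, h2]; ring
      _ = (om l G ρ z * ((1 - aF l G ρ z) * (1 - l * bF l G ρ z))) *
          (1 + aF l G ν (om l G ρ z)) * (1 + l * bF l G ν (om l G ρ z)) := by ring
      _ = _ := by rw [h3]
  have hf : ∀ z ∈ UHP, om l G ρ z -
      r * (1 + aF l G ν (om l G ρ z)) * (1 + l * bF l G ν (om l G ρ z)) =
      (z - r) * (1 + aF l G ν (om l G ρ z)) * (1 + l * bF l G ν (om l G ρ z)) := by
    intro z hz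
    conv_lhs => rw [sub_eq_add_neg]; arg 1; rw [(hkey z hz).1]
    ring
  refine boundary_limit (B := 1 + |r|) (ω := om l G ρ)
    (f := fun w => (w - r * (1 + aF l G ν w) * (1 + l * bF l G ν w)) /
      ((w + I) * (1 + aF l G ν w + I) * (1 + l * bF l G ν w + I))) ?_ ?_ ?_ ?_ ?_ ?_
  · intro w hw
    obtain ⟨h1, h2⟩ := aF_diff hl G ν hw
    have h3 := hd w hw
    refine DifferentiableAt.differentiableWithinAt ?_
    refine DifferentiableAt.div ?_ ?_ h3
    · fun_prop
    · fun_prop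
  · intro w hw
    obtain ⟨w1, w2⟩ := norm_le_add_I (le_of_lt hw : 0 ≤ w.im)
    obtain ⟨a1, a2⟩ := norm_le_add_I (hA w hw)
    obtain ⟨b1, b2⟩ := norm_le_add_I (hB w hw)
    rw [norm_div, div_le_iff₀ (norm_pos_iff.2 (hd w hw)), norm_mul, norm_mul]
    refine (norm_sub_le _ _).trans ?_
    rw [norm_mul, norm_mul, Complex.norm_real, Real.norm_eq_abs]
    generalize ‖w + I‖ = x at *
    generalize ‖1 + aF l G ν w + I‖ = y at *
    generalize ‖1 + l * bF l G ν w + I‖ = u at *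
    have y1 : 1 ≤ y * u := one_le_mul_of_one_le_of_one_le a2 b2
    have n1 : ‖1 + aF l G ν w‖ * ‖1 + l * bF l G ν w‖ ≤ y * u := by gcongr
    have n2 : ‖w‖ ≤ x * (y * u) := by nlinarith
    have n3 : y * u ≤ x * (y * u) := by nlinarith
    have n4 := mul_le_mul_of_nonneg_left (n1.trans n3) (abs_nonneg r)
    nlinarith
  · have hi : (I : ℂ) ∈ UHP := by simp [mem_UHP]
    refine ⟨om l G ρ I, (subord_all hl G ν ρ hconv hi).1, ?_⟩
    refine div_ne_zero ?_ (hd _ (subord_all hl G ν ρ hconv hi).1)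
    rw [hf I hi]
    refine mul_ne_zero (mul_ne_zero ?_ (hkey I hi).2.1) (hkey I hi).2.2
    intro h
    have := congrArg Complex.im h
    simp at this
  · intro z hz
    exact (om_diff_UHP hl G ρ hz).continuousAt.continuousWithinAt
  · intro z hz
    exact (subord_all hl G ν ρ hconv hz).1
  · intro z hz
    have hw := (subord_all hl G ν ρ hconv hz).1
    show ‖(om l G ρ z - r * (1 + aF l G ν (om l G ρ z)) * (1 + l * bF l G ν (om l G ρ z))) / _‖ ≤ _
    rw [hf z hz]
    obtain ⟨w1, w2⟩ := norm_le_add_I (le_of_lt hw : 0 ≤ (om l G ρ z).im)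
    obtain ⟨a1, a2⟩ := norm_le_add_I (hA _ hw)
    obtain ⟨b1, b2⟩ := norm_le_add_I (hB _ hw)
    rw [norm_div, div_le_iff₀ (norm_pos_iff.2 (hd _ hw)), norm_mul, norm_mul, norm_mul, norm_mul]
    generalize ‖om l G ρ z + I‖ = x at *
    generalize ‖1 + aF l G ν (om l G ρ z) + I‖ = y at *
    generalize ‖1 + l * bF l G ν (om l G ρ z) + I‖ = u at *
    have y1 : 1 ≤ y * u := one_le_mul_of_one_le_of_one_le a2 b2
    have n1 : ‖1 + aF l G ν (om l G ρ z)‖ * ‖1 + l * bF l G ν (om l G ρ z)‖ ≤ y * u := by gcongr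
    have n3 : y * u ≤ x * (y * u) := by nlinarith
    have n4 := mul_le_mul_of_nonneg_left (n1.trans n3) (norm_nonneg (z - r))
    nlinarith

/-- The restriction to `ℂ⁺` of the subordination function
`ω₂(z) = H_ρ(z)/T(M_ρ(z) - C(H_ρ(z)))` extends continuously to `(0,+∞)`, with values in
`ℂ ∪ {∞}`. -/
theorem stmt13 (l : ℝ) (hl : l ∈ Set.Ioo (0 : ℝ) 1)
    (μ : Measure ℝ) [IsProbabilityMeasure μ]
    (hμsym : Measure.map (fun t : ℝ => -t) μ = μ)
    (G : Measure ℝ) [IsFiniteMeasure G]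
    (hGsym : Measure.map (fun t : ℝ => -t) G = G)
    (hID : IsRectInfDiv l μ G)
    (ν ρ : Measure ℝ) [IsProbabilityMeasure ν] [IsProbabilityMeasure ρ]
    (hνsym : Measure.map (fun t : ℝ => -t) ν = ν)
    (hρsym : Measure.map (fun t : ℝ => -t) ρ = ρ)
    (hconv : IsRectConv l G ν ρ) :
    ∀ r : ℝ, 0 < r → ∃ L : OnePoint ℂ,
      Tendsto
        (fun z : ℂ =>
          ((Ht l ρ z / Tfun l (Mt ρ z - rectC G (Ht l ρ z)) : ℂ) : OnePoint ℂ))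
        (nhdsWithin (r : ℂ) UHP) (nhds L) := by
  intro r _
  exact main_limit hl G ν ρ hconv r

end
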